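/- arXiv:2410.19137 — 2 statements merged into one kernel-verified Lean document; each statement's English description precedes it below -/
import Mathlib

section
/- Let d ≥ 1, p,q ∈ (1,∞), β > 0, and let g ≥ 0 be a Borel function on ℝ^{d+1} such that ∫_{ℝ^{d+1}} g·|f| dx dt ≤ ‖f‖_{E_{p,q,β}} for every bounded smooth function f on ℝ^{d+1}. Then for every f ∈ E_{p,q,β} one has ∫_{ℝ^{d+1}} g·|f| dx dt ≤ ‖f‖_{E_{p,q,β}}, and moreover lim_{ε↓0} ∫_{ℝ^{d+1}} g·|f − f^{(ε)}| dx dt = 0. -/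
open MeasureTheory ENNReal NNReal Metric Set Filter Topology

noncomputable section

/-- Euclidean space `ℝ^d`. -/
abbrev Spc (d : ℕ) : Type := EuclideanSpace ℝ (Fin d)

/-- Space-time `ℝ^{d+1} = ℝ × ℝ^d`, a point is `(t, x)`. -/
abbrev SpT (d : ℕ) : Type := ℝ × Spc d

/-- The parabolic cylinder `C_ρ(t₀,x₀) = [t₀, t₀+ρ²) × B_ρ(x₀)`. -/
def pCyl (d : ℕ) (ρ t₀ : ℝ) (x₀ : Spc d) : Set (SpT d) :=
  (Set.Ico t₀ (t₀ + ρ ^ 2)) ×ˢ (Metric.ball x₀ ρ)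

/-- The (unnormalized) norm `‖f‖_{L_{p,q}(A)}
    = (∫_ℝ (∫_{ℝ^d} |f(t,x)|^p 1_A(t,x) dx)^{q/p} dt)^{1/q}`. -/
def lpqNorm (d : ℕ) (p q : ℝ) (f : SpT d → ℝ) (A : Set (SpT d)) : ℝ≥0∞ :=
  (∫⁻ t : ℝ, (∫⁻ x : Spc d, A.indicator (fun z => ENNReal.ofReal |f z| ^ p) (t, x)) ^ (q / p)) ^ (1 / q)

/-- The normalized norm `⨍‖f‖_{L_{p,q}(C)}` over the cylinder `C_ρ(t₀,x₀)`:
    inner integral replaced by the average over the spatial ball, outer one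
    by the average over the time interval. -/
def avgLpq (d : ℕ) (p q ρ t₀ : ℝ) (x₀ : Spc d) (f : SpT d → ℝ) : ℝ≥0∞ :=
  ((∫⁻ t in Set.Ico t₀ (t₀ + ρ ^ 2),
      ((∫⁻ x in Metric.ball x₀ ρ, ENNReal.ofReal |f (t, x)| ^ p) / volume (Metric.ball x₀ ρ)) ^ (q / p))
      / ENNReal.ofReal (ρ ^ 2)) ^ (1 / q)

/-- The parabolic Morrey norm `‖f‖_{E_{p,q,β}}
    = sup { ρ^β ⨍‖f‖_{L_{p,q}(C)} : 0 < ρ ≤ 1, C ∈ ℂ_ρ }`. -/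
def morreyNorm (d : ℕ) (p q β : ℝ) (f : SpT d → ℝ) : ℝ≥0∞ :=
  ⨆ (ρ : ℝ) (_ : 0 < ρ) (_ : ρ ≤ 1) (t₀ : ℝ) (x₀ : Spc d),
    ENNReal.ofReal (ρ ^ β) * avgLpq d p q ρ t₀ x₀ f

/-- The homogeneous parabolic Morrey norm `‖f‖_{Ė_{p,q,β}}` (all radii `ρ > 0`). -/
def morreyNormH (d : ℕ) (p q β : ℝ) (f : SpT d → ℝ) : ℝ≥0∞ :=
  ⨆ (ρ : ℝ) (_ : 0 < ρ) (t₀ : ℝ) (x₀ : Spc d),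
    ENNReal.ofReal (ρ ^ β) * avgLpq d p q ρ t₀ x₀ f

/-- Membership `f ∈ E_{p,q,β}`. -/
def MemE (d : ℕ) (p q β : ℝ) (f : SpT d → ℝ) : Prop :=
  AEStronglyMeasurable f volume ∧ morreyNorm d p q β f ≠ ⊤

/-- Membership `f ∈ Ė_{p,q,β}` (homogeneous). -/
def MemEH (d : ℕ) (p q β : ℝ) (f : SpT d → ℝ) : Prop :=
  AEStronglyMeasurable f volume ∧ morreyNormH d p q β f ≠ ⊤

/-- The elliptic Morrey norm `‖f‖_{E_{p,β}(ℝ^d)}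
    = sup { ρ^β (⨍_{B_ρ(x)} |f|^p)^{1/p} : 0 < ρ ≤ 1, x ∈ ℝ^d }`. -/
def morreyNormE (d : ℕ) (p β : ℝ) (f : Spc d → ℝ) : ℝ≥0∞ :=
  ⨆ (ρ : ℝ) (_ : 0 < ρ) (_ : ρ ≤ 1) (x₀ : Spc d),
    ENNReal.ofReal (ρ ^ β) *
      ((∫⁻ y in Metric.ball x₀ ρ, ENNReal.ofReal |f y| ^ p) / volume (Metric.ball x₀ ρ)) ^ (1 / p)

/-- The homogeneous elliptic Morrey norm on `ℝ^d` (all radii `ρ > 0`). -/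
def morreyNormEH (d : ℕ) (p β : ℝ) (f : Spc d → ℝ) : ℝ≥0∞ :=
  ⨆ (ρ : ℝ) (_ : 0 < ρ) (x₀ : Spc d),
    ENNReal.ofReal (ρ ^ β) *
      ((∫⁻ y in Metric.ball x₀ ρ, ENNReal.ofReal |f y| ^ p) / volume (Metric.ball x₀ ρ)) ^ (1 / p)

/-- A mollifying kernel: nonnegative, smooth, compactly supported in
    `[-1,0) × B_1(0)`, with unit integral. -/
def IsMollifier (d : ℕ) (ζ : SpT d → ℝ) : Prop :=
  ContDiff ℝ (⊤ : ℕ∞) ζ ∧ (∀ z, 0 ≤ ζ z) ∧ (∫ z, ζ z) = 1 ∧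
    Function.support ζ ⊆ (Set.Ico (-1 : ℝ) 0) ×ˢ (Metric.ball (0 : Spc d) 1)

/-- The mollification `f^{(ε)} = f * ζ_ε`, where
    `ζ_ε(t,x) = ε^{-d-2} ζ(t/ε², x/ε)`. -/
def mollify (d : ℕ) (ζ : SpT d → ℝ) (ε : ℝ) (f : SpT d → ℝ) (z : SpT d) : ℝ :=
  ∫ w : SpT d, (ε ^ (-(d : ℝ) - 2) * ζ (w.1 / ε ^ 2, ε⁻¹ • w.2)) * f (z.1 - w.1, z.2 - w.2)

/-- The time direction in space-time. -/
def dirT (d : ℕ) : SpT d := (1, 0)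

/-- The `i`-th spatial direction in space-time. -/
def dirS (d : ℕ) (i : Fin d) : SpT d := (0, EuclideanSpace.single i 1)

/-- `v` is the weak derivative of `u` in the direction `e`. -/
def IsWeakDeriv (d : ℕ) (u v : SpT d → ℝ) (e : SpT d) : Prop :=
  ∀ φ : SpT d → ℝ, ContDiff ℝ (⊤ : ℕ∞) φ → HasCompactSupport φ →
    ∫ z, u z * fderiv ℝ φ z e = - ∫ z, v z * φ z

/-- `v` is the second weak derivative of `u` in the directions `e₁, e₂`. -/
def IsWeakDeriv2 (d : ℕ) (u v : SpT d → ℝ) (e₁ e₂ : SpT d) : Prop :=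
  ∀ φ : SpT d → ℝ, ContDiff ℝ (⊤ : ℕ∞) φ → HasCompactSupport φ →
    ∫ z, u z * fderiv ℝ (fun w => fderiv ℝ φ w e₁) z e₂ = ∫ z, v z * φ z

/-- The magnitude `|Du|` of the spatial gradient. -/
def gradMag (d : ℕ) (Du : Fin d → SpT d → ℝ) (z : SpT d) : ℝ :=
  Real.sqrt (∑ i, (Du i z) ^ 2)

/-- The magnitude `|D²u|` of the spatial Hessian. -/
def hessMag (d : ℕ) (D2u : Fin d → Fin d → SpT d → ℝ) (z : SpT d) : ℝ :=
  Real.sqrt (∑ i, ∑ j, (D2u i j z) ^ 2)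

/-- `u ∈ E^{1,2}_{p,q,β}`, with weak spatial gradient `Du`, weak spatial Hessian
    `D2u`, and weak time derivative `ut`, all in `E_{p,q,β}`. -/
def Mem12 (d : ℕ) (p q β : ℝ) (u : SpT d → ℝ) (Du : Fin d → SpT d → ℝ)
    (D2u : Fin d → Fin d → SpT d → ℝ) (ut : SpT d → ℝ) : Prop :=
  MemE d p q β u ∧ (∀ i, IsWeakDeriv d u (Du i) (dirS d i)) ∧
    (∀ i j, IsWeakDeriv2 d u (D2u i j) (dirS d i) (dirS d j)) ∧
    IsWeakDeriv d u ut (dirT d) ∧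
    (∀ i, MemE d p q β (Du i)) ∧ (∀ i j, MemE d p q β (D2u i j)) ∧ MemE d p q β ut

/-- `u ∈ Ė^{1,2}_{p,q,β}` (homogeneous version). -/
def Mem12H (d : ℕ) (p q β : ℝ) (u : SpT d → ℝ) (Du : Fin d → SpT d → ℝ)
    (D2u : Fin d → Fin d → SpT d → ℝ) (ut : SpT d → ℝ) : Prop :=
  MemEH d p q β u ∧ (∀ i, IsWeakDeriv d u (Du i) (dirS d i)) ∧
    (∀ i j, IsWeakDeriv2 d u (D2u i j) (dirS d i) (dirS d j)) ∧
    IsWeakDeriv d u ut (dirT d) ∧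
    (∀ i, MemEH d p q β (Du i)) ∧ (∀ i j, MemEH d p q β (D2u i j)) ∧ MemEH d p q β ut

/-- The norm `‖u‖_{E^{1,2}_{p,q,β}} = ‖u‖ + ‖Du‖ + ‖D²u‖ + ‖∂ₜu‖`. -/
def norm12 (d : ℕ) (p q β : ℝ) (u : SpT d → ℝ) (Du : Fin d → SpT d → ℝ)
    (D2u : Fin d → Fin d → SpT d → ℝ) (ut : SpT d → ℝ) : ℝ≥0∞ :=
  morreyNorm d p q β u + morreyNorm d p q β (gradMag d Du)
    + morreyNorm d p q β (hessMag d D2u) + morreyNorm d p q β ut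

/-- Membership `f ∈ L_{p,q}(ℝ^{d+1})`. -/
def MemLpq (d : ℕ) (p q : ℝ) (f : SpT d → ℝ) : Prop :=
  AEStronglyMeasurable f volume ∧ lpqNorm d p q f Set.univ ≠ ⊤

/-- `u ∈ W^{1,2}_{p,q}(ℝ^{d+1})`: `u`, its weak spatial gradient `Du`,
    weak spatial Hessian `D2u` and weak time derivative `ut` are in `L_{p,q}`. -/
def MemW12 (d : ℕ) (p q : ℝ) (u : SpT d → ℝ) (Du : Fin d → SpT d → ℝ)
    (D2u : Fin d → Fin d → SpT d → ℝ) (ut : SpT d → ℝ) : Prop :=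
  MemLpq d p q u ∧ (∀ i, IsWeakDeriv d u (Du i) (dirS d i)) ∧
    (∀ i j, IsWeakDeriv2 d u (D2u i j) (dirS d i) (dirS d j)) ∧
    IsWeakDeriv d u ut (dirT d) ∧
    (∀ i, MemLpq d p q (Du i)) ∧ (∀ i j, MemLpq d p q (D2u i j)) ∧ MemLpq d p q ut

/-- Convergence `F ε → v` in `L_r(B)` as `ε ↓ 0`. -/
def TendstoLr (d : ℕ) (r : ℝ) (B : Set (Spc d)) (F : ℝ → Spc d → ℝ) (v : Spc d → ℝ) : Prop :=
  Tendsto (fun ε => (∫⁻ x in B, ENNReal.ofReal |F ε x - v x| ^ r) ^ (1 / r))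
    (𝓝[>] (0 : ℝ)) (𝓝 0)

section LpNorm

variable {α Ω : Type*} [MeasurableSpace α] [MeasurableSpace Ω]

/-- The `L_p` norm of an `ℝ≥0∞`-valued function, for a real exponent. -/
def lpNrm (p : ℝ) (μ : Measure α) (u : α → ℝ≥0∞) : ℝ≥0∞ := (∫⁻ a, u a ^ p ∂μ) ^ (1 / p)

variable {p r : ℝ} {μ : Measure α} {u v : α → ℝ≥0∞}

lemma lpNrm_mono_ae (hp : 0 < p) (h : ∀ᵐ a ∂μ, u a ≤ v a) : lpNrm p μ u ≤ lpNrm p μ v := by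
  unfold lpNrm
  gcongr ?_ ^ _
  refine lintegral_mono_ae ?_
  filter_upwards [h] with a ha
  gcongr

lemma lpNrm_mono (hp : 0 < p) (h : ∀ a, u a ≤ v a) : lpNrm p μ u ≤ lpNrm p μ v :=
  lpNrm_mono_ae hp (ae_of_all _ h)

lemma lpNrm_congr_ae (h : ∀ᵐ a ∂μ, u a = v a) : lpNrm p μ u = lpNrm p μ v := by
  unfold lpNrm
  congr 1
  refine lintegral_congr_ae ?_
  filter_upwards [h] with a ha
  rw [ha]

lemma lpNrm_add_le (hp : 1 ≤ p) (hu : Measurable u) (hv : Measurable v) :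
    lpNrm p μ (fun a => u a + v a) ≤ lpNrm p μ u + lpNrm p μ v :=
  ENNReal.lintegral_Lp_add_le hu.aemeasurable hv.aemeasurable hp

lemma lpNrm_const_mul (hp : 0 < p) {c : ℝ≥0∞} (hc : c ≠ ⊤) :
    lpNrm p μ (fun a => c * u a) = c * lpNrm p μ u := by
  unfold lpNrm
  simp_rw [ENNReal.mul_rpow_of_nonneg _ _ hp.le]
  rw [lintegral_const_mul' _ _ (ENNReal.rpow_ne_top_of_nonneg hp.le hc),
    ENNReal.mul_rpow_of_nonneg _ _ (by positivity), ← ENNReal.rpow_mul,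
    mul_one_div_cancel hp.ne', ENNReal.rpow_one]

lemma lpNrm_zero (hp : 0 < p) : lpNrm p μ (fun _ => 0) = 0 := by
  simp [lpNrm, hp]

lemma lpNrm_rpow (hp : 0 < p) : lpNrm p μ u ^ p = ∫⁻ a, u a ^ p ∂μ := by
  rw [lpNrm, ← ENNReal.rpow_mul, one_div_mul_cancel hp.ne', ENNReal.rpow_one]

lemma lpNrm_le_of_lintegral_le (hp : 0 < p) {A : ℝ≥0∞} (h : ∫⁻ a, u a ^ p ∂μ ≤ A ^ p) :
    lpNrm p μ u ≤ A := by
  calc lpNrm p μ u ≤ (A ^ p) ^ (1 / p) := by unfold lpNrm; gcongr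
    _ = A := by rw [← ENNReal.rpow_mul, mul_one_div_cancel hp.ne', ENNReal.rpow_one]

lemma lpNrm_le_mul_measure (hp : 0 < p) (hpr : p ≤ r) (hu : Measurable u) :
    lpNrm p μ u ≤ lpNrm r μ u * μ univ ^ (1 / p - 1 / r) := by
  simpa [eLpNorm', lpNrm] using
    eLpNorm'_le_eLpNorm'_mul_rpow_measure_univ hp hpr (μ := μ) hu.aestronglyMeasurable

lemma lpNrm_indicator (hp : 0 < p) {s : Set α} (hs : MeasurableSet s) :
    lpNrm p μ (s.indicator u) = lpNrm p (μ.restrict s) u := by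
  unfold lpNrm
  rw [← lintegral_indicator hs]
  congr 2
  ext a
  by_cases ha : a ∈ s <;> simp [ha, hp]

lemma measurable_lpNrm_prod [SFinite μ] {F : Ω × α → ℝ≥0∞} (hF : Measurable F) :
    Measurable fun w => lpNrm p μ fun a => F (w, a) :=
  ((hF.pow_const p).lintegral_prod_right').pow_const _

lemma tendsto_lpNrm_of_dominated (hp : 0 < p) {U : ℕ → α → ℝ≥0∞} (hU : ∀ n, Measurable (U n))
    (hv : lpNrm p μ v ≠ ⊤) (hle : ∀ n a, U n a ≤ v a)
    (hlim : ∀ᵐ a ∂μ, Tendsto (fun n => U n a) atTop (𝓝 0)) :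
    Tendsto (fun n => lpNrm p μ (U n)) atTop (𝓝 0) := by
  have h1 : Tendsto (fun n => ∫⁻ a, U n a ^ p ∂μ) atTop (𝓝 (∫⁻ _, 0 ∂μ)) := by
    refine tendsto_lintegral_of_dominated_convergence (fun a => v a ^ p)
      (fun n => (hU n).pow_const p)
      (fun n => ae_of_all _ fun a => by have := hle n a; dsimp only; gcongr) ?_ ?_
    · rw [← lpNrm_rpow hp]
      exact ENNReal.rpow_ne_top_of_nonneg hp.le hv
    · filter_upwards [hlim] with a ha
      simpa [hp, Function.comp_def] using
        (ENNReal.continuous_rpow_const (y := p)).continuousAt.tendsto.comp ha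
  have := (ENNReal.continuous_rpow_const (y := 1 / p)).continuousAt.tendsto.comp h1
  simpa [hp, lpNrm, Function.comp_def] using this

/-- **Minkowski's integral inequality** with respect to a probability measure. -/
lemma lpNrm_lintegral_le [SFinite μ] (hp : 1 < p) (κ : Measure Ω) [IsProbabilityMeasure κ]
    {F : α × Ω → ℝ≥0∞} (hF : Measurable F) :
    lpNrm p μ (fun a => ∫⁻ w, F (a, w) ∂κ) ≤ ∫⁻ w, lpNrm p μ (fun a => F (a, w)) ∂κ := by
  have hp0 : 0 < p := by linarith
  set A : Ω → ℝ≥0∞ := fun w => lpNrm p μ (fun a => F (a, w)) with hA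
  have hAm : Measurable A := measurable_lpNrm_prod (hF.comp measurable_swap)
  refine ENNReal.le_of_forall_pos_le_add fun η hη hfin => ?_
  have hη0 : (η : ℝ≥0∞) ≠ 0 := by exact_mod_cast hη.ne'
  set b : Ω → ℝ≥0∞ := fun w => A w + η with hb
  have hbm : Measurable b := hAm.add_const _
  have hb0 : ∀ w, b w ≠ 0 := fun w => by simp [hb, hη0]
  have hbt : ∀ᵐ w ∂κ, b w ≠ ⊤ := by
    filter_upwards [ae_lt_top hAm hfin.ne] with w hw
    simp [hb, hw.ne]
  have hB : ∫⁻ w, b w ∂κ = ∫⁻ w, A w ∂κ + η := by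
    simp [hb, lintegral_add_right]
  set s : ℝ := (p - 1) / p with hs
  have hpp : p.HolderConjugate p.conjExponent := Real.HolderConjugate.conjExponent hp
  have hs' : 1 / p.conjExponent = s := by
    rw [Real.conjExponent, one_div_div]
  have hG : ∀ a, (∫⁻ w, F (a, w) ∂κ) ^ p ≤
      (∫⁻ w, F (a, w) ^ p * b w ^ (-(p - 1)) ∂κ) * (∫⁻ w, b w ∂κ) ^ (p - 1) := by
    intro a
    have hFa : Measurable fun w => F (a, w) := hF.comp measurable_prodMk_left
    have h1 : ∫⁻ w, F (a, w) ∂κ = ∫⁻ w, (fun w => F (a, w) * b w ^ (-s)) w * b w ^ s ∂κ := by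
      refine lintegral_congr_ae ?_
      filter_upwards [hbt] with w hw
      rw [mul_assoc, ← ENNReal.rpow_add _ _ (hb0 w) hw]
      simp
    have h2 := ENNReal.lintegral_mul_le_Lp_mul_Lq κ hpp
      (f := fun w => F (a, w) * b w ^ (-s)) (g := fun w => b w ^ s)
      (hFa.mul (hbm.pow_const _)).aemeasurable (hbm.pow_const _).aemeasurable
    have h3 : ∀ w, (b w ^ s) ^ p.conjExponent = b w := fun w => by
      rw [← ENNReal.rpow_mul, ← hs', one_div_mul_cancel hpp.symm.pos.ne', ENNReal.rpow_one]
    have h4 : ∀ w, (F (a, w) * b w ^ (-s)) ^ p = F (a, w) ^ p * b w ^ (-(p - 1)) := fun w => by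
      rw [ENNReal.mul_rpow_of_nonneg _ _ hp0.le, ← ENNReal.rpow_mul]
      congr 2
      rw [hs]
      field_simp
    simp only [h3, h4, Pi.mul_apply, hs'] at h2
    rw [h1]
    refine (ENNReal.rpow_le_rpow h2 hp0.le).trans_eq ?_
    rw [ENNReal.mul_rpow_of_nonneg _ _ hp0.le, ← ENNReal.rpow_mul, ← ENNReal.rpow_mul,
      one_div_mul_cancel hp0.ne', ENNReal.rpow_one]
    congr 2
    rw [hs]
    field_simp
  rw [← hB]
  refine lpNrm_le_of_lintegral_le hp0 ?_
  have hFb : Measurable fun z : α × Ω => F z ^ p * b z.2 ^ (-(p - 1)) :=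
    (hF.pow_const _).mul ((hbm.comp measurable_snd).pow_const _)
  calc ∫⁻ a, (∫⁻ w, F (a, w) ∂κ) ^ p ∂μ
      ≤ ∫⁻ a, (∫⁻ w, F (a, w) ^ p * b w ^ (-(p - 1)) ∂κ) * (∫⁻ w, b w ∂κ) ^ (p - 1) ∂μ :=
        lintegral_mono hG
    _ = (∫⁻ a, ∫⁻ w, F (a, w) ^ p * b w ^ (-(p - 1)) ∂κ ∂μ) * (∫⁻ w, b w ∂κ) ^ (p - 1) :=
        lintegral_mul_const _ hFb.lintegral_prod_right'
    _ = (∫⁻ w, ∫⁻ a, F (a, w) ^ p * b w ^ (-(p - 1)) ∂μ ∂κ) * (∫⁻ w, b w ∂κ) ^ (p - 1) := by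
        rw [lintegral_lintegral_swap hFb.aemeasurable]
    _ = (∫⁻ w, A w ^ p * b w ^ (-(p - 1)) ∂κ) * (∫⁻ w, b w ∂κ) ^ (p - 1) := by
        congr 2
        ext w
        have hm : Measurable fun a => F (a, w) ^ p :=
          (hF.comp measurable_prodMk_right).pow_const _
        rw [lintegral_mul_const _ hm, lpNrm_rpow hp0]
    _ ≤ (∫⁻ w, b w ∂κ) * (∫⁻ w, b w ∂κ) ^ (p - 1) := by
        gcongr ?_ * _
        refine lintegral_mono_ae ?_
        filter_upwards [hbt] with w hw
        calc A w ^ p * b w ^ (-(p - 1)) ≤ b w ^ p * b w ^ (-(p - 1)) := by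
              gcongr
              exact le_self_add
          _ = b w := by
              rw [← ENNReal.rpow_add _ _ (hb0 w) hw]
              simp
    _ = (∫⁻ w, b w ∂κ) ^ p := by
        have h0 : ∫⁻ w, b w ∂κ ≠ 0 := by simp [hB, hη0]
        have ht : ∫⁻ w, b w ∂κ ≠ ⊤ := by simp [hB, hfin.ne]
        nth_rw 1 [← ENNReal.rpow_one (∫⁻ w, b w ∂κ)]
        rw [← ENNReal.rpow_add _ _ h0 ht]
        simp

end LpNorm

section MixedNorm

variable {d : ℕ} {p q r : ℝ} {u v : SpT d → ℝ≥0∞}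

/-- The mixed norm `L_{p,q}` over the whole space-time: `p` in space, then `q` in time. -/
def mixNrm (d : ℕ) (p q : ℝ) (u : SpT d → ℝ≥0∞) : ℝ≥0∞ :=
  lpNrm q volume fun t : ℝ => lpNrm p volume fun x : Spc d => u (t, x)

lemma mixNrm_mono (hp : 0 < p) (hq : 0 < q) (h : ∀ z, u z ≤ v z) :
    mixNrm d p q u ≤ mixNrm d p q v :=
  lpNrm_mono hq fun _ => lpNrm_mono hp fun _ => h _

lemma mixNrm_congr_ae (h : u =ᵐ[volume] v) : mixNrm d p q u = mixNrm d p q v := by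
  rw [Measure.volume_eq_prod] at h
  refine lpNrm_congr_ae ?_
  filter_upwards [Measure.ae_ae_of_ae_prod h] with t ht
  exact lpNrm_congr_ae ht

lemma mixNrm_add_le (hp : 1 ≤ p) (hq : 1 ≤ q) (hu : Measurable u) (hv : Measurable v) :
    mixNrm d p q (fun z => u z + v z) ≤ mixNrm d p q u + mixNrm d p q v := by
  refine (lpNrm_mono (by linarith) fun t => ?_).trans
    (lpNrm_add_le hq (measurable_lpNrm_prod hu) (measurable_lpNrm_prod hv))
  exact lpNrm_add_le hp (hu.comp measurable_prodMk_left) (hv.comp measurable_prodMk_left)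

lemma mixNrm_const_mul (hp : 0 < p) (hq : 0 < q) {c : ℝ≥0∞} (hc : c ≠ ⊤) :
    mixNrm d p q (fun z => c * u z) = c * mixNrm d p q u := by
  unfold mixNrm
  simp_rw [lpNrm_const_mul hp hc]
  exact lpNrm_const_mul hq hc

lemma mixNrm_zero (hp : 0 < p) (hq : 0 < q) : mixNrm d p q (fun _ => 0) = 0 := by
  simp [mixNrm, lpNrm_zero hp, lpNrm_zero hq]

lemma mixNrm_lintegral_le (hp : 1 < p) (hq : 1 < q) {Ω : Type*} [MeasurableSpace Ω]
    (κ : Measure Ω) [IsProbabilityMeasure κ] {F : SpT d × Ω → ℝ≥0∞} (hF : Measurable F) :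
    mixNrm d p q (fun z => ∫⁻ w, F (z, w) ∂κ) ≤ ∫⁻ w, mixNrm d p q (fun z => F (z, w)) ∂κ := by
  have h1 : Measurable fun y : (ℝ × Ω) × Spc d => F ((y.1.1, y.2), y.1.2) := by fun_prop
  refine (lpNrm_mono (by linarith) fun t => ?_).trans
    (lpNrm_lintegral_le hq κ (F := fun y : ℝ × Ω =>
      lpNrm p volume fun x : Spc d => F ((y.1, x), y.2)) (measurable_lpNrm_prod h1))
  have h2 : Measurable fun y : Spc d × Ω => F ((t, y.1), y.2) := by fun_prop
  exact lpNrm_lintegral_le hp κ (F := fun y : Spc d × Ω => F ((t, y.1), y.2)) h2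

lemma mixNrm_translate (u : SpT d → ℝ≥0∞) (w : SpT d) :
    mixNrm d p q (fun z => u (z - w)) = mixNrm d p q u := by
  obtain ⟨s, y⟩ := w
  unfold mixNrm lpNrm
  simp only [Prod.mk_sub_mk]
  have h1 : ∀ t, ∫⁻ x : Spc d, u (t - s, x - y) ^ p = ∫⁻ x : Spc d, u (t - s, x) ^ p :=
    fun t => lintegral_sub_right_eq_self (fun x : Spc d => u (t - s, x) ^ p) y
  simp_rw [h1]
  rw [lintegral_sub_right_eq_self
    (fun t : ℝ => ((∫⁻ x : Spc d, u (t, x) ^ p) ^ (1 / p)) ^ q) s]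

lemma lpNrm_ne_top_ae {α : Type*} [MeasurableSpace α] {μ : Measure α} {v : α → ℝ≥0∞} (hq : 0 < q)
    (hv : Measurable v) (h : lpNrm q μ v ≠ ⊤) : ∀ᵐ a ∂μ, v a ≠ ⊤ := by
  have h1 : ∫⁻ a, v a ^ q ∂μ ≠ ⊤ := by
    rw [← lpNrm_rpow hq]
    exact ENNReal.rpow_ne_top_of_nonneg hq.le h
  filter_upwards [ae_lt_top (hv.pow_const q) h1] with a ha hat
  simp [hat, hq] at ha

lemma tendsto_mixNrm_of_dominated (hp : 0 < p) (hq : 0 < q) {U : ℕ → SpT d → ℝ≥0∞}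
    (hU : ∀ n, Measurable (U n)) (hv : Measurable v) (hfin : mixNrm d p q v ≠ ⊤)
    (hle : ∀ n z, U n z ≤ v z) (hlim : ∀ z, Tendsto (fun n => U n z) atTop (𝓝 0)) :
    Tendsto (fun n => mixNrm d p q (U n)) atTop (𝓝 0) := by
  refine tendsto_lpNrm_of_dominated hq (fun n => measurable_lpNrm_prod (hU n)) hfin
    (fun n t => lpNrm_mono hp fun x => hle n _) ?_
  filter_upwards [lpNrm_ne_top_ae hq (measurable_lpNrm_prod hv) hfin] with t ht
  exact tendsto_lpNrm_of_dominated hp (fun n => (hU n).comp measurable_prodMk_left) ht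
    (fun n x => hle n _) (ae_of_all _ fun x => hlim _)

lemma mixNrm_indicator_prod (hp : 0 < p) (hq : 0 < q) {I : Set ℝ} {B : Set (Spc d)}
    (hI : MeasurableSet I) (hB : MeasurableSet B) :
    mixNrm d p q ((I ×ˢ B).indicator u) = lpNrm q (volume.restrict I)
      fun t => lpNrm p (volume.restrict B) fun x => u (t, x) := by
  rw [← lpNrm_indicator hq hI]
  unfold mixNrm
  congr 1
  ext t
  by_cases ht : t ∈ I
  · rw [indicator_of_mem ht, ← lpNrm_indicator hp hB]
    congr 1
    ext x
    by_cases hx : x ∈ B <;> simp [ht, hx]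
  · rw [indicator_of_notMem ht, ← lpNrm_zero (μ := (volume : Measure (Spc d))) hp]
    congr 1
    ext x
    simp [ht]

/-- On bounded product sets the mixed norm is controlled by any larger isotropic norm. -/
lemma mixNrm_indicator_le_lintegral (hp : 0 < p) (hq : 0 < q) (hpr : p ≤ r) (hqr : q ≤ r)
    (hu : Measurable u) {I : Set ℝ} {B : Set (Spc d)}
    (hI : MeasurableSet I) (hB : MeasurableSet B) (hBt : volume B ≠ ⊤) :
    mixNrm d p q ((I ×ˢ B).indicator u) ≤
      volume B ^ (1 / p - 1 / r) * volume I ^ (1 / q - 1 / r) * lpNrm r volume u := by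
  have hr : 0 < r := hp.trans_le hpr
  have e1 : 0 ≤ 1 / p - 1 / r := sub_nonneg.2 (one_div_le_one_div_of_le hp hpr)
  rw [mixNrm_indicator_prod hp hq hI hB]
  have hm : Measurable fun t => lpNrm r (volume.restrict B) fun x => u (t, x) :=
    measurable_lpNrm_prod hu
  calc _ ≤ lpNrm q (volume.restrict I) fun t => volume B ^ (1 / p - 1 / r) *
          lpNrm r (volume.restrict B) fun x => u (t, x) := by
        refine lpNrm_mono hq fun t => ?_
        have := lpNrm_le_mul_measure (μ := volume.restrict B) hp hpr
          (hu.comp (measurable_prodMk_left (x := t)))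
        rw [Measure.restrict_apply_univ, mul_comm] at this
        exact this
    _ = volume B ^ (1 / p - 1 / r) * lpNrm q (volume.restrict I) fun t =>
          lpNrm r (volume.restrict B) fun x => u (t, x) :=
        lpNrm_const_mul hq (ENNReal.rpow_ne_top_of_nonneg e1 hBt)
    _ ≤ volume B ^ (1 / p - 1 / r) * (lpNrm r (volume.restrict I) (fun t =>
          lpNrm r (volume.restrict B) fun x => u (t, x)) * volume I ^ (1 / q - 1 / r)) := by
        gcongr
        simpa using lpNrm_le_mul_measure (μ := volume.restrict I) hq hqr hm
    _ ≤ volume B ^ (1 / p - 1 / r) * (lpNrm r volume u * volume I ^ (1 / q - 1 / r)) := by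
        gcongr
        unfold lpNrm
        gcongr
        simp_rw [← ENNReal.rpow_mul, one_div_mul_cancel hr.ne', ENNReal.rpow_one]
        rw [Measure.volume_eq_prod, lintegral_prod _ (hu.pow_const r).aemeasurable]
        refine (setLIntegral_le_lintegral _ _).trans (lintegral_mono fun t => ?_)
        exact setLIntegral_le_lintegral _ _
    _ = _ := by ring

end MixedNorm

section Cylinder

variable {d : ℕ} {p q β ρ t : ℝ} {x : Spc d} {u v : SpT d → ℝ≥0∞}

lemma measurableSet_pCyl (ρ t : ℝ) (x : Spc d) : MeasurableSet (pCyl d ρ t x) :=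
  measurableSet_Ico.prod measurableSet_ball

/-- The reciprocal of the `L_{p,q}` norm of the indicator of a cylinder of radius `ρ`. -/
def cylConst (d : ℕ) (p q ρ : ℝ) : ℝ≥0∞ :=
  volume (ball (0 : Spc d) ρ) ^ (-(1 / p)) * ENNReal.ofReal (ρ ^ 2) ^ (-(1 / q))

/-- The normalized `L_{p,q}` norm of an `ℝ≥0∞`-valued function on a cylinder. -/
def cylNrm (d : ℕ) (p q ρ t : ℝ) (x : Spc d) (u : SpT d → ℝ≥0∞) : ℝ≥0∞ :=
  cylConst d p q ρ * mixNrm d p q ((pCyl d ρ t x).indicator u)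

lemma volume_ball_ne_zero (hρ : 0 < ρ) : volume (ball (0 : Spc d) ρ) ≠ 0 :=
  (measure_ball_pos _ _ hρ).ne'

lemma cylConst_ne_top (hρ : 0 < ρ) : cylConst d p q ρ ≠ ⊤ := by
  refine ENNReal.mul_ne_top ?_ ?_
  · exact ENNReal.rpow_ne_top_of_ne_zero (volume_ball_ne_zero hρ) measure_ball_lt_top.ne
  · exact ENNReal.rpow_ne_top_of_ne_zero (by simpa using hρ.ne') ENNReal.ofReal_ne_top

lemma cylConst_anti (hp : 0 < p) (hq : 0 < q) {δ : ℝ} (hδ : 0 < δ) (h : δ ≤ ρ) :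
    cylConst d p q ρ ≤ cylConst d p q δ := by
  unfold cylConst
  simp_rw [ENNReal.rpow_neg]
  gcongr

lemma cylNrm_mono (hp : 0 < p) (hq : 0 < q) (h : ∀ z ∈ pCyl d ρ t x, u z ≤ v z) :
    cylNrm d p q ρ t x u ≤ cylNrm d p q ρ t x v := by
  unfold cylNrm
  gcongr
  refine mixNrm_mono hp hq fun z => ?_
  by_cases hz : z ∈ pCyl d ρ t x
  · simpa [hz] using h z hz
  · simp [hz]

lemma cylNrm_congr_ae (h : u =ᵐ[volume] v) : cylNrm d p q ρ t x u = cylNrm d p q ρ t x v := by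
  unfold cylNrm
  congr 1
  refine mixNrm_congr_ae ?_
  filter_upwards [h] with z hz
  simp [indicator, hz]

lemma cylNrm_add_le (hp : 1 ≤ p) (hq : 1 ≤ q) (hu : Measurable u) (hv : Measurable v) :
    cylNrm d p q ρ t x (fun z => u z + v z) ≤ cylNrm d p q ρ t x u + cylNrm d p q ρ t x v := by
  unfold cylNrm
  rw [← mul_add]
  gcongr
  have := mixNrm_add_le hp hq (hu.indicator (measurableSet_pCyl ρ t x))
    (hv.indicator (measurableSet_pCyl ρ t x))
  refine le_trans (le_of_eq ?_) this
  congr 1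
  ext z
  by_cases hz : z ∈ pCyl d ρ t x <;> simp [hz]

lemma cylNrm_const_mul (hp : 0 < p) (hq : 0 < q) {c : ℝ≥0∞} (hc : c ≠ ⊤) :
    cylNrm d p q ρ t x (fun z => c * u z) = c * cylNrm d p q ρ t x u := by
  have : (pCyl d ρ t x).indicator (fun z => c * u z)
      = fun z => c * (pCyl d ρ t x).indicator u z := by
    ext z
    by_cases hz : z ∈ pCyl d ρ t x <;> simp [hz]
  unfold cylNrm
  rw [this, mixNrm_const_mul hp hq hc]
  ring

lemma cylNrm_eq_zero (hp : 0 < p) (hq : 0 < q) (h : ∀ z ∈ pCyl d ρ t x, u z = 0) :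
    cylNrm d p q ρ t x u = 0 := by
  have : (pCyl d ρ t x).indicator u = fun _ => 0 := by
    ext z
    by_cases hz : z ∈ pCyl d ρ t x
    · simpa [hz] using h z hz
    · simp [hz]
  unfold cylNrm
  rw [this, mixNrm_zero hp hq, mul_zero]

lemma cylNrm_one (hp : 0 < p) (hq : 0 < q) (hρ : 0 < ρ) :
    cylNrm d p q ρ t x (fun _ => 1) = 1 := by
  have hV := volume_ball_ne_zero (d := d) hρ
  have hV' : volume (ball (0 : Spc d) ρ) ≠ ⊤ := measure_ball_lt_top.ne
  have hR : ENNReal.ofReal (ρ ^ 2) ≠ 0 := by simpa using hρ.ne'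
  unfold cylNrm cylConst pCyl
  rw [mixNrm_indicator_prod hp hq measurableSet_Ico measurableSet_ball]
  simp only [lpNrm, ENNReal.one_rpow, lintegral_const, Measure.restrict_apply_univ, one_mul,
    Measure.addHaar_ball_center volume x, Real.volume_Ico, add_sub_cancel_left]
  rw [ENNReal.mul_rpow_of_nonneg _ _ (by positivity), ← ENNReal.rpow_mul _ q,
    mul_one_div_cancel hq.ne', ENNReal.rpow_one, mul_mul_mul_comm,
    ← ENNReal.rpow_add _ _ hV hV', ← ENNReal.rpow_add _ _ hR ENNReal.ofReal_ne_top]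
  simp

lemma cylNrm_le_of_le (hp : 0 < p) (hq : 0 < q) (hρ : 0 < ρ) {k : ℝ≥0∞} (hk : k ≠ ⊤)
    (h : ∀ z, u z ≤ k) : cylNrm d p q ρ t x u ≤ k := by
  refine (cylNrm_mono hp hq (v := fun _ => k * 1) fun z _ => by simpa using h z).trans_eq ?_
  rw [cylNrm_const_mul hp hq hk, cylNrm_one hp hq hρ, mul_one]

lemma cylNrm_translate (u : SpT d → ℝ≥0∞) (w : SpT d) :
    cylNrm d p q ρ t x (fun z => u (z - w)) = cylNrm d p q ρ (t - w.1) (x - w.2) u := by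
  unfold cylNrm
  rw [← mixNrm_translate ((pCyl d ρ (t - w.1) (x - w.2)).indicator u) w]
  congr 2
  ext z
  have : z - w ∈ pCyl d ρ (t - w.1) (x - w.2) ↔ z ∈ pCyl d ρ t x := by
    simp only [pCyl, mem_prod, mem_Ico, mem_ball, Prod.fst_sub, Prod.snd_sub, dist_sub_right,
      sub_le_sub_iff_right]
    rw [sub_add_eq_add_sub, sub_lt_sub_iff_right]
  by_cases hz : z ∈ pCyl d ρ t x
  · rw [indicator_of_mem hz, indicator_of_mem (this.2 hz)]
  · rw [indicator_of_notMem hz, indicator_of_notMem (mt this.1 hz)]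

lemma cylNrm_lintegral_le (hp : 1 < p) (hq : 1 < q) {Ω : Type*} [MeasurableSpace Ω]
    (κ : Measure Ω) [IsProbabilityMeasure κ] (hρ : 0 < ρ)
    {F : SpT d × Ω → ℝ≥0∞} (hF : Measurable F) :
    cylNrm d p q ρ t x (fun z => ∫⁻ w, F (z, w) ∂κ) ≤
      ∫⁻ w, cylNrm d p q ρ t x (fun z => F (z, w)) ∂κ := by
  unfold cylNrm
  rw [lintegral_const_mul' _ _ (cylConst_ne_top hρ)]
  gcongr
  have hG : Measurable ((pCyl d ρ t x ×ˢ univ).indicator F) :=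
    hF.indicator ((measurableSet_pCyl ρ t x).prod MeasurableSet.univ)
  have := mixNrm_lintegral_le hp hq κ hG
  refine le_trans (le_of_eq ?_) (this.trans_eq ?_)
  · congr 1
    ext z
    by_cases hz : z ∈ pCyl d ρ t x <;> simp [indicator, hz]
  · congr 1
    ext w
    congr 1
    ext z
    by_cases hz : z ∈ pCyl d ρ t x <;> simp [indicator, hz]

lemma avgLpq_eq_cylNrm (hp : 0 < p) (hq : 0 < q) (hρ : 0 < ρ) (f : SpT d → ℝ) :
    avgLpq d p q ρ t x f = cylNrm d p q ρ t x fun z => ENNReal.ofReal |f z| := by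
  have hV := volume_ball_ne_zero (d := d) hρ
  have hV' : volume (ball (0 : Spc d) ρ) ≠ ⊤ := measure_ball_lt_top.ne
  have hR : ENNReal.ofReal (ρ ^ 2) ≠ 0 := by simpa using hρ.ne'
  unfold avgLpq cylNrm cylConst pCyl
  rw [mixNrm_indicator_prod hp hq measurableSet_Ico measurableSet_ball]
  simp only [lpNrm, Measure.addHaar_ball_center volume x, div_eq_mul_inv _ (volume _),
    ENNReal.mul_rpow_of_nonneg _ _ (div_nonneg hq.le hp.le)]
  rw [lintegral_mul_const' _ _ (ENNReal.rpow_ne_top_of_nonneg (by positivity)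
    (ENNReal.inv_ne_top.2 hV)), div_eq_mul_inv _ (ENNReal.ofReal _),
    ENNReal.mul_rpow_of_nonneg _ _ (by positivity), ENNReal.mul_rpow_of_nonneg _ _ (by positivity)]
  simp only [ENNReal.inv_rpow, ENNReal.rpow_neg, ← ENNReal.rpow_mul]
  have e1 : q / p * (1 / q) = 1 / p := by field_simp
  have e2 : 1 / p * q = q / p := by ring
  rw [e1, e2]
  ring

/-- The Morrey norm of an `ℝ≥0∞`-valued function. -/
def morreyNrm (d : ℕ) (p q β : ℝ) (u : SpT d → ℝ≥0∞) : ℝ≥0∞ :=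
  ⨆ (ρ : ℝ) (_ : 0 < ρ) (_ : ρ ≤ 1) (t : ℝ) (x : Spc d),
    ENNReal.ofReal (ρ ^ β) * cylNrm d p q ρ t x u

lemma morreyNorm_eq_morreyNrm (hp : 0 < p) (hq : 0 < q) (f : SpT d → ℝ) :
    morreyNorm d p q β f = morreyNrm d p q β fun z => ENNReal.ofReal |f z| := by
  unfold morreyNorm morreyNrm
  refine iSup_congr fun ρ => iSup_congr fun hρ => ?_
  simp_rw [avgLpq_eq_cylNrm hp hq hρ]

lemma le_morreyNrm (hρ : 0 < ρ) (hρ1 : ρ ≤ 1) (t : ℝ) (x : Spc d) (u : SpT d → ℝ≥0∞) :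
    ENNReal.ofReal (ρ ^ β) * cylNrm d p q ρ t x u ≤ morreyNrm d p q β u :=
  le_iSup_of_le ρ <| le_iSup_of_le hρ <| le_iSup_of_le hρ1 <| le_iSup_of_le t <|
    le_iSup_of_le x le_rfl

lemma morreyNrm_le {A : ℝ≥0∞} (h : ∀ ρ : ℝ, 0 < ρ → ρ ≤ 1 → ∀ (t : ℝ) (x : Spc d),
    ENNReal.ofReal (ρ ^ β) * cylNrm d p q ρ t x u ≤ A) : morreyNrm d p q β u ≤ A :=
  iSup_le fun ρ => iSup_le fun hρ => iSup_le fun hρ1 => iSup_le fun t => iSup_le fun x =>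
    h ρ hρ hρ1 t x

lemma morreyNrm_mono (hp : 0 < p) (hq : 0 < q) (h : ∀ z, u z ≤ v z) :
    morreyNrm d p q β u ≤ morreyNrm d p q β v :=
  morreyNrm_le fun ρ hρ hρ1 t x =>
    le_trans (by gcongr; exact cylNrm_mono hp hq fun z _ => h z) (le_morreyNrm hρ hρ1 t x v)

lemma morreyNrm_congr_ae (h : u =ᵐ[volume] v) : morreyNrm d p q β u = morreyNrm d p q β v := by
  unfold morreyNrm
  simp_rw [cylNrm_congr_ae h]

/-- Averaging over translations does not increase the Morrey norm. -/
lemma morreyNrm_average_le (hp : 1 < p) (hq : 1 < q) (κ : Measure (SpT d))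
    [IsProbabilityMeasure κ] (hv : Measurable v) (h : ∀ z, u z ≤ ∫⁻ w, v (z - w) ∂κ) :
    morreyNrm d p q β u ≤ morreyNrm d p q β v := by
  refine morreyNrm_le fun ρ hρ hρ1 t x => ?_
  have hF : Measurable fun y : SpT d × SpT d => v (y.1 - y.2) := by fun_prop
  calc ENNReal.ofReal (ρ ^ β) * cylNrm d p q ρ t x u
      ≤ ENNReal.ofReal (ρ ^ β) * ∫⁻ w, cylNrm d p q ρ t x (fun z => v (z - w)) ∂κ := by
        gcongr
        exact (cylNrm_mono (by linarith) (by linarith) fun z _ => h z).trans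
          (cylNrm_lintegral_le hp hq κ hρ hF)
    _ = ∫⁻ w, ENNReal.ofReal (ρ ^ β) * cylNrm d p q ρ (t - w.1) (x - w.2) v ∂κ := by
        rw [lintegral_const_mul' _ _ ENNReal.ofReal_ne_top]
        simp_rw [cylNrm_translate]
    _ ≤ ∫⁻ _, morreyNrm d p q β v ∂κ := lintegral_mono fun w => le_morreyNrm hρ hρ1 _ _ v
    _ = morreyNrm d p q β v := by simp

end Cylinder

section Duality

variable {d : ℕ} {p q β : ℝ} {G : SpT d → ℝ≥0∞}

instance volume_spT_isAddHaarMeasure (d : ℕ) : (volume : Measure (SpT d)).IsAddHaarMeasure := by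
  rw [Measure.volume_eq_prod]
  infer_instance

lemma isProbabilityMeasure_withDensity_ofReal {k : SpT d → ℝ} (hk : Integrable k)
    (h0 : ∀ z, 0 ≤ k z) (h1 : ∫ z, k z = 1) :
    IsProbabilityMeasure ((volume : Measure (SpT d)).withDensity fun z => ENNReal.ofReal (k z)) :=
  ⟨by
    rw [withDensity_apply _ MeasurableSet.univ, Measure.restrict_univ,
      ← ofReal_integral_eq_lintegral_ofReal hk (ae_of_all _ h0), h1, ENNReal.ofReal_one]⟩

lemma lintegral_mul_le_morreyNrm_of_bounded (hp : 1 < p) (hq : 1 < q) (hG : Measurable G)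
    (hGt : ∀ z, G z ≠ ⊤)
    (H : ∀ f : SpT d → ℝ, ContDiff ℝ (⊤ : ℕ∞) f → (∃ M, ∀ z, |f z| ≤ M) →
      ∫⁻ z, G z * ENNReal.ofReal |f z| ≤ morreyNorm d p q β f)
    {f : SpT d → ℝ} (hf : Measurable f) {M : ℝ} (hM : ∀ z, |f z| ≤ M) :
    ∫⁻ z, G z * ENNReal.ofReal |f z| ≤ morreyNrm d p q β fun z => ENNReal.ofReal |f z| := by
  have hloc : LocallyIntegrable f volume :=
    (locallyIntegrable_const M).mono hf.aestronglyMeasurable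
      (ae_of_all _ fun z => by simpa using (hM z).trans (le_abs_self M))
  let φ : ℕ → ContDiffBump (0 : SpT d) := fun n =>
    ⟨1 / (n + 1 : ℝ) / 2, 1 / (n + 1 : ℝ), by positivity, half_lt_self (by positivity)⟩
  let k : ℕ → SpT d → ℝ := fun n => (φ n).normed volume
  let F : ℕ → SpT d → ℝ := fun n =>
    MeasureTheory.convolution (k n) f (ContinuousLinearMap.lsmul ℝ ℝ) volume
  have hkc : ∀ n, Continuous (k n) := fun n => (φ n).continuous_normed
  have hFle : ∀ n z, ENNReal.ofReal |F n z| ≤ ∫⁻ w, ENNReal.ofReal |f (z - w)|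
      ∂(volume.withDensity fun w => ENNReal.ofReal (k n w)) := by
    intro n z
    rw [lintegral_withDensity_eq_lintegral_mul _ (by fun_prop) (by fun_prop)]
    have := enorm_integral_le_lintegral_enorm (μ := volume) fun w : SpT d => k n w • f (z - w)
    simp only [enorm_smul, Real.enorm_eq_ofReal_abs] at this
    simpa [k, F, MeasureTheory.convolution, abs_of_nonneg ((φ n).nonneg_normed _)] using this
  have hprob : ∀ n, IsProbabilityMeasure
      ((volume : Measure (SpT d)).withDensity fun w => ENNReal.ofReal (k n w)) := fun n =>
    isProbabilityMeasure_withDensity_ofReal (φ n).integrable_normed (fun z => (φ n).nonneg_normed z)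
      (φ n).integral_normed
  have hbound : ∀ n z, |F n z| ≤ M := by
    intro n z
    have hM0 : 0 ≤ M := (abs_nonneg _).trans (hM z)
    have := hprob n
    rw [← ENNReal.ofReal_le_ofReal_iff hM0]
    refine (hFle n z).trans ((lintegral_mono fun w => ENNReal.ofReal_le_ofReal (hM _)).trans ?_)
    simp
  have hlim : ∀ᵐ z, Tendsto (fun n => F n z) atTop (𝓝 (f z)) := by
    refine ContDiffBump.ae_convolution_tendsto_right_of_locallyIntegrable (K := 2)
      tendsto_one_div_add_atTop_nhds_zero_nat (Eventually.of_forall fun n => ?_) hloc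
    simp only [φ]
    linarith
  have hsmooth : ∀ n, ContDiff ℝ (⊤ : ℕ∞) (F n) := fun n =>
    (φ n).hasCompactSupport_normed.contDiff_convolution_left _ (φ n).contDiff_normed hloc
  calc ∫⁻ z, G z * ENNReal.ofReal |f z|
      ≤ ∫⁻ z, liminf (fun n => G z * ENNReal.ofReal |F n z|) atTop := by
        refine lintegral_mono_ae ?_
        filter_upwards [hlim] with z hz
        refine le_of_eq (Tendsto.liminf_eq ?_).symm
        exact ENNReal.Tendsto.const_mul (ENNReal.tendsto_ofReal hz.abs) (Or.inr (hGt z))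
    _ ≤ liminf (fun n => ∫⁻ z, G z * ENNReal.ofReal |F n z|) atTop :=
        lintegral_liminf_le fun n => hG.mul (hsmooth n).continuous.measurable.abs.ennreal_ofReal
    _ ≤ morreyNrm d p q β fun z => ENNReal.ofReal |f z| := by
        refine (liminf_le_liminf (v := fun _ => morreyNrm d p q β fun z => ENNReal.ofReal |f z|)
          (Eventually.of_forall fun n => ?_)).trans_eq (by simp)
        have := hprob n
        refine (H (F n) (hsmooth n) ⟨M, hbound n⟩).trans ?_
        rw [morreyNorm_eq_morreyNrm (by linarith) (by linarith)]
        exact morreyNrm_average_le hp hq _ hf.abs.ennreal_ofReal (hFle n)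

lemma lintegral_mul_le_morreyNrm (hp : 1 < p) (hq : 1 < q) (hG : Measurable G)
    (hGt : ∀ z, G z ≠ ⊤)
    (H : ∀ f : SpT d → ℝ, ContDiff ℝ (⊤ : ℕ∞) f → (∃ M, ∀ z, |f z| ≤ M) →
      ∫⁻ z, G z * ENNReal.ofReal |f z| ≤ morreyNorm d p q β f)
    {u : SpT d → ℝ≥0∞} (hu : Measurable u) :
    ∫⁻ z, G z * u z ≤ morreyNrm d p q β u := by
  have hlim : ∀ z, ⨆ n : ℕ, min (u z) n = u z := by
    intro z
    rw [← inf_iSup_eq, ENNReal.iSup_natCast, inf_top_eq]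
  have h1 : ∫⁻ z, G z * u z = ⨆ n : ℕ, ∫⁻ z, G z * min (u z) n := by
    have hm : ∀ n : ℕ, Measurable fun z => G z * min (u z) n := fun n =>
      hG.mul (hu.min measurable_const)
    rw [← lintegral_iSup hm]
    · refine lintegral_congr fun z => ?_
      rw [← ENNReal.mul_iSup, hlim z]
    · intro m n hmn z
      dsimp only
      gcongr
  rw [h1]
  refine iSup_le fun n => ?_
  have hfin : ∀ z, min (u z) n ≠ ⊤ := fun z => ((min_le_right _ _).trans_lt (by simp)).ne
  have h2 : ∀ z, ENNReal.ofReal |(min (u z) n).toReal| = min (u z) n := fun z => by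
    rw [abs_of_nonneg ENNReal.toReal_nonneg, ENNReal.ofReal_toReal (hfin z)]
  have := lintegral_mul_le_morreyNrm_of_bounded hp hq hG hGt H
    (f := fun z => (min (u z) n).toReal) (hu.min measurable_const).ennreal_toReal (M := n)
    fun z => by
      rw [abs_of_nonneg ENNReal.toReal_nonneg]
      exact ENNReal.toReal_le_of_le_ofReal (by positivity) (by simp)
  simp only [h2] at this
  exact this.trans (morreyNrm_mono (by linarith) (by linarith) fun z => min_le_left _ _)

end Duality

section GlidingHump

variable {d : ℕ} {p q β : ℝ} {G : SpT d → ℝ≥0∞}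

/-- Functions in the unit ball of the Morrey space whose weighted averages are at most `1 / m` on
all cylinders of radius at least `1 / m` based in the box of size `m` about the origin. -/
def spreadBall (d : ℕ) (p q β : ℝ) (m : ℕ) : Set (SpT d → ℝ≥0∞) :=
  {h | Measurable h ∧ morreyNrm d p q β h ≤ 1 ∧
    ∀ ρ : ℝ, 0 < ρ → ρ ≤ 1 → 1 ≤ m * ρ → ∀ (t : ℝ) (x : Spc d), |t| ≤ m → ‖x‖ ≤ m →
      ENNReal.ofReal (ρ ^ β) * cylNrm d p q ρ t x h ≤ (m : ℝ≥0∞)⁻¹}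

lemma spreadBall_anti {m n : ℕ} (hmn : m ≤ n) : spreadBall d p q β n ⊆ spreadBall d p q β m := by
  rintro h ⟨hm, h1, h2⟩
  have hmn' : (m : ℝ) ≤ n := by exact_mod_cast hmn
  refine ⟨hm, h1, fun ρ hρ hρ1 hmρ t x ht hx => ?_⟩
  refine (h2 ρ hρ hρ1 (hmρ.trans (by gcongr)) t x (ht.trans hmn') (hx.trans hmn')).trans ?_
  gcongr

lemma spreadBall_of_le (hp : 0 < p) (hq : 0 < q) {m : ℕ} {h k : SpT d → ℝ≥0∞}
    (hh : h ∈ spreadBall d p q β m) (hk : Measurable k) (hle : ∀ z, k z ≤ h z) :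
    k ∈ spreadBall d p q β m := by
  obtain ⟨-, h1, h2⟩ := hh
  refine ⟨hk, (morreyNrm_mono hp hq hle).trans h1, fun ρ hρ hρ1 hmρ t x ht hx => ?_⟩
  refine le_trans ?_ (h2 ρ hρ hρ1 hmρ t x ht hx)
  gcongr
  exact cylNrm_mono hp hq fun z _ => hle z

/-- Integrals against a fixed function are approximated by bounded, boundedly supported ones. -/
lemma exists_truncation_lt (hG : Measurable G) {h : SpT d → ℝ≥0∞} (hh : Measurable h)
    {a : ℝ≥0∞} (ha : a < ∫⁻ z, G z * h z) :
    ∃ (k : ℕ) (u : SpT d → ℝ≥0∞), Measurable u ∧ (∀ z, u z ≤ h z) ∧ (∀ z, u z ≤ k) ∧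
      (∀ z, u z ≠ 0 → |z.1| ≤ k ∧ ‖z.2‖ ≤ k) ∧ a < ∫⁻ z, G z * u z := by
  let s : ℕ → Set (SpT d) := fun n => {z | |z.1| ≤ n ∧ ‖z.2‖ ≤ n}
  have hs : ∀ n, MeasurableSet (s n) := fun n =>
    (measurableSet_le (f := fun z : SpT d => |z.1|) (by fun_prop) measurable_const).inter
      (measurableSet_le (f := fun z : SpT d => ‖z.2‖) (by fun_prop) measurable_const)
  let u : ℕ → SpT d → ℝ≥0∞ := fun n => (s n).indicator fun z => min (h z) n
  have hu : ∀ n, Measurable (u n) := fun n => (hh.min measurable_const).indicator (hs n)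
  have hmono : Monotone u := by
    intro m n hmn z
    have hmn' : (m : ℝ) ≤ n := by exact_mod_cast hmn
    by_cases hz : z ∈ s m
    · have hz' : z ∈ s n := ⟨hz.1.trans hmn', hz.2.trans hmn'⟩
      simp only [u, indicator_of_mem hz, indicator_of_mem hz']
      gcongr
    · simp [u, indicator_of_notMem hz]
  have hsup : ∀ z, ⨆ n, u n z = h z := by
    intro z
    refine tendsto_nhds_unique (tendsto_atTop_iSup fun m n hmn => hmono hmn z) ?_
    have h1 : Tendsto (fun n : ℕ => min (h z) (n : ℝ≥0∞)) atTop (𝓝 (min (h z) ⊤)) :=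
      tendsto_const_nhds.min ENNReal.tendsto_nat_nhds_top
    rw [min_top_right] at h1
    refine h1.congr' ?_
    filter_upwards [eventually_ge_atTop ⌈max |z.1| ‖z.2‖⌉₊] with n hn
    have := Nat.ceil_le.1 hn
    have hz : z ∈ s n := ⟨(le_max_left _ _).trans this, (le_max_right _ _).trans this⟩
    simp [u, hz]
  have hsupr : ∫⁻ z, G z * h z = ⨆ n, ∫⁻ z, G z * u n z := by
    have hm : ∀ n, Measurable fun z => G z * u n z := fun n => hG.mul (hu n)
    rw [← lintegral_iSup hm]
    · refine lintegral_congr fun z => ?_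
      rw [← ENNReal.mul_iSup, hsup z]
    · intro m n hmn z
      exact mul_le_mul_right (hmono hmn z) _
  rw [hsupr] at ha
  obtain ⟨k, hk⟩ := lt_iSup_iff.1 ha
  refine ⟨k, u k, hu k, fun z => ?_, fun z => ?_, fun z hz => ?_, hk⟩
  · exact (indicator_le_self _ _ z).trans (min_le_left _ _)
  · exact (indicator_le_self _ _ z).trans (min_le_right _ _)
  · have : z ∈ s k := mem_of_indicator_ne_zero hz
    exact this

lemma exists_forall_rpow_mul_le_half (hβ : 0 < β) (k : ℕ) :
    ∃ N : ℕ, ∀ ρ : ℝ, 0 < ρ → N * ρ < 1 → ENNReal.ofReal (ρ ^ β) * k ≤ 2⁻¹ := by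
  have h1 : Tendsto (fun ρ : ℝ => ENNReal.ofReal (ρ ^ β) * k) (𝓝 0) (𝓝 0) := by
    have := ENNReal.Tendsto.mul_const (b := (k : ℝ≥0∞)) (ENNReal.tendsto_ofReal
      (Real.continuousAt_rpow_const 0 β (Or.inr hβ.le)).tendsto) (Or.inr (by simp))
    simpa [Real.zero_rpow hβ.ne'] using this
  obtain ⟨δ, hδ, h2⟩ := Metric.eventually_nhds_iff.1
    (h1.eventually_le_const (u := 2⁻¹) (by simp))
  obtain ⟨N, hN⟩ := exists_nat_gt δ⁻¹
  refine ⟨N, fun ρ hρ hNρ => h2 ?_⟩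
  rw [Real.dist_0_eq_abs, abs_of_pos hρ]
  by_contra! hle
  have : δ⁻¹ * δ < N * ρ := by nlinarith [inv_pos.2 hδ]
  rw [inv_mul_cancel₀ hδ.ne'] at this
  linarith

lemma two_thirds_mul_le_one {a b : ℝ≥0∞} (ha : a ≤ 1) (hb : b ≤ 2⁻¹) : 2 / 3 * (a + b) ≤ 1 := by
  calc (2 / 3 : ℝ≥0∞) * (a + b) ≤ 2 / 3 * (1 + 2⁻¹) := by gcongr
    _ = ENNReal.ofReal (2 / 3) * (ENNReal.ofReal 1 + ENNReal.ofReal 2⁻¹) := by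
        rw [ENNReal.ofReal_div_of_pos (by norm_num), ENNReal.ofReal_inv_of_pos (by norm_num)]
        simp
    _ = 1 := by
        rw [← ENNReal.ofReal_add (by norm_num) (by norm_num), ← ENNReal.ofReal_mul (by norm_num)]
        norm_num

lemma two_thirds_mul_add_self (a : ℝ≥0∞) : 2 / 3 * (a + a) = 4 / 3 * a := by
  rw [← two_mul, ← mul_assoc]
  congr 1
  rw [div_eq_mul_inv, div_eq_mul_inv, mul_right_comm]
  norm_num

/-- If every `spreadBall` contains an element with integral exceeding `a`, then sums of two such
elements living on very different scales or far from each other yield the larger bound `4a/3`. -/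
lemma exists_mem_spreadBall_improve (hp : 1 < p) (hq : 1 < q) (hβ : 0 < β) (hG : Measurable G)
    {a : ℝ≥0∞} (H : ∀ m, ∃ h ∈ spreadBall d p q β m, a < ∫⁻ z, G z * h z) (m : ℕ) :
    ∃ h ∈ spreadBall d p q β m, 4 / 3 * a < ∫⁻ z, G z * h z := by
  have hp0 : 0 < p := by linarith
  have hq0 : 0 < q := by linarith
  set n := m + 1 with hn
  obtain ⟨h₀, hh₀, hlt₀⟩ := H (2 * n)
  obtain ⟨k, h, hhm, hle, hk, hsupp, hlt⟩ := exists_truncation_lt hG hh₀.1 hlt₀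
  have hh := spreadBall_of_le hp0 hq0 hh₀ hhm hle
  obtain ⟨N, hN⟩ := exists_forall_rpow_mul_le_half hβ k
  set M := max (2 * n) (max (k + 2) N) with hM
  have hM1 : 2 * n ≤ M := le_max_left _ _
  have hM2 : k + 2 ≤ M := (le_max_left _ _).trans (le_max_right _ _)
  have hM3 : N ≤ M := (le_max_right _ _).trans (le_max_right _ _)
  obtain ⟨h', hh', hlt'⟩ := H M
  have hc : (2 / 3 : ℝ≥0∞) ≠ ⊤ := ENNReal.div_ne_top (by simp) (by simp)
  have hc1 : (2 / 3 : ℝ≥0∞) ≤ 1 := by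
    simpa using two_thirds_mul_le_one (a := 1) (b := 0) le_rfl (by simp)
  have key : ∀ (ρ t : ℝ) (x : Spc d),
      ENNReal.ofReal (ρ ^ β) * cylNrm d p q ρ t x (fun z => 2 / 3 * (h z + h' z)) ≤
      2 / 3 * (ENNReal.ofReal (ρ ^ β) * cylNrm d p q ρ t x h +
        ENNReal.ofReal (ρ ^ β) * cylNrm d p q ρ t x h') := by
    intro ρ t x
    rw [cylNrm_const_mul hp0 hq0 hc, ← mul_add, mul_left_comm]
    gcongr
    exact cylNrm_add_le hp.le hq.le hhm hh'.1
  refine ⟨fun z => 2 / 3 * (h z + h' z), spreadBall_anti (Nat.le_succ m)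
    ⟨(hhm.add hh'.1).const_mul _, morreyNrm_le fun ρ hρ hρ1 t x => ?_,
      fun ρ hρ hρ1 hmρ t x ht hx => ?_⟩, ?_⟩
  · have b1 := (le_morreyNrm hρ hρ1 t x h).trans hh.2.1
    have b2 := (le_morreyNrm hρ hρ1 t x h').trans hh'.2.1
    refine (key ρ t x).trans ?_
    by_cases hMρ : M * ρ < 1
    · rw [add_comm]
      refine two_thirds_mul_le_one b2 (le_trans ?_ (hN ρ hρ (lt_of_le_of_lt ?_ hMρ)))
      · gcongr
        exact cylNrm_le_of_le hp0 hq0 hρ (by simp) hk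
      · gcongr
    by_cases htx : |t| ≤ M ∧ ‖x‖ ≤ M
    · refine two_thirds_mul_le_one b1 ((hh'.2.2 ρ hρ hρ1 (not_lt.1 hMρ) t x htx.1 htx.2).trans ?_)
      rw [ENNReal.inv_le_inv]
      have : 2 ≤ M := by omega
      exact_mod_cast this
    · have hz : cylNrm d p q ρ t x h = 0 := by
        refine cylNrm_eq_zero hp0 hq0 fun z hz => ?_
        by_contra hne
        obtain ⟨hz1, hz2⟩ := hsupp z hne
        obtain ⟨⟨c1, c2⟩, c3⟩ := hz
        have hM2' : (k : ℝ) + 2 ≤ M := by exact_mod_cast hM2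
        refine htx ⟨?_, ?_⟩
        · rw [abs_le] at hz1 ⊢
          constructor <;> nlinarith
        · have : ‖x‖ ≤ ‖z.2‖ + dist z.2 x := by
            rw [dist_eq_norm']
            calc ‖x‖ = ‖z.2 + (x - z.2)‖ := by simp
              _ ≤ _ := norm_add_le _ _
          rw [mem_ball] at c3
          linarith
      rw [hz, mul_zero, add_comm]
      exact two_thirds_mul_le_one b2 (by simp)
  · have hnn : (n : ℝ) ≤ (2 * n : ℕ) := by push_cast; linarith [Nat.cast_nonneg (α := ℝ) n]
    have hnM : (n : ℝ) ≤ M := hnn.trans (by exact_mod_cast hM1)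
    have b1 := hh.2.2 ρ hρ hρ1 (hmρ.trans (by gcongr)) t x (ht.trans hnn) (hx.trans hnn)
    have b2 := hh'.2.2 ρ hρ hρ1 (hmρ.trans (by gcongr)) t x (ht.trans hnM) (hx.trans hnM)
    have b3 : (M : ℝ≥0∞)⁻¹ ≤ ((2 * n : ℕ) : ℝ≥0∞)⁻¹ := by
      rw [ENNReal.inv_le_inv]
      exact_mod_cast hM1
    calc _ ≤ _ := key ρ t x
      _ ≤ 1 * (((2 * n : ℕ) : ℝ≥0∞)⁻¹ + ((2 * n : ℕ) : ℝ≥0∞)⁻¹) := by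
          gcongr
          exact b2.trans b3
      _ = (n : ℝ≥0∞)⁻¹ := by
          rw [one_mul, Nat.cast_mul, ENNReal.mul_inv (by simp) (by simp), ← add_mul]
          simp [ENNReal.inv_two_add_inv_two]
  · have e : ∫⁻ z, G z * (2 / 3 * (h z + h' z)) =
        2 / 3 * ((∫⁻ z, G z * h z) + ∫⁻ z, G z * h' z) := by
      have hm : Measurable fun z => G z * h z := hG.mul hhm
      rw [← lintegral_add_left hm, ← lintegral_const_mul' _ _ hc]
      refine lintegral_congr fun z => ?_
      ring
    rw [e, ← two_thirds_mul_add_self]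
    exact (ENNReal.mul_lt_mul_iff_right (by simp) hc).2 (ENNReal.add_lt_add hlt hlt')

/-- A weight which is bounded on the unit ball of the Morrey space is uniformly small on
functions that are small at large scales in a large box. -/
lemma exists_forall_spreadBall_le (hp : 1 < p) (hq : 1 < q) (hβ : 0 < β) (hG : Measurable G)
    (H : ∀ u : SpT d → ℝ≥0∞, Measurable u → ∫⁻ z, G z * u z ≤ morreyNrm d p q β u)
    {a : ℝ≥0∞} (ha : a ≠ 0) : ∃ m, ∀ h ∈ spreadBall d p q β m, ∫⁻ z, G z * h z ≤ a := by
  by_contra! hcon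
  have hall : ∀ k : ℕ, ∀ m, ∃ h ∈ spreadBall d p q β m, (4 / 3) ^ k * a < ∫⁻ z, G z * h z := by
    intro k
    induction k with
    | zero => simpa using hcon
    | succ k ih =>
      intro m
      have := exists_mem_spreadBall_improve hp hq hβ hG ih m
      rwa [← mul_assoc, ← pow_succ'] at this
  have hle : ∀ k : ℕ, (4 / 3) ^ k * a ≤ 1 := by
    intro k
    obtain ⟨h, hh, hlt⟩ := hall k 0
    exact hlt.le.trans ((H h hh.1).trans hh.2.1)
  have h43 : (1 : ℝ≥0∞) < 4 / 3 := by
    rw [ENNReal.lt_div_iff_mul_lt (by simp) (by simp)]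
    norm_num
  have ht : Tendsto (fun k : ℕ => (4 / 3 : ℝ≥0∞) ^ k * a) atTop (𝓝 (⊤ * a)) :=
    ENNReal.Tendsto.mul_const (ENNReal.tendsto_pow_atTop_nhds_top_iff.2 h43) (Or.inl (by simp))
  rw [ENNReal.top_mul ha] at ht
  exact absurd (le_of_tendsto' ht hle) (by simp)

end GlidingHump

section LocalContinuity

variable {d : ℕ} {p q r β : ℝ}

lemma tendsto_lpNrm_translate_sub (hr : 1 ≤ r) {f : SpT d → ℝ}
    (hf : MemLp f (ENNReal.ofReal r) volume) :
    Tendsto (fun w => lpNrm r volume fun z => ENNReal.ofReal |f (z - w) - f z|)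
      (𝓝 0) (𝓝 0) := by
  have : Fact (1 ≤ ENNReal.ofReal r) := ⟨by simpa using hr⟩
  let g : SpT d → C(SpT d, SpT d) := fun w => ⟨fun z => z - w, by fun_prop⟩
  have hg : Continuous g := ContinuousMap.continuous_of_continuous_uncurry g (by
    change Continuous fun y : SpT d × SpT d => y.2 - y.1
    fun_prop)
  have hgm : ∀ w, MeasurePreserving (g w) (volume : Measure (SpT d)) volume := fun w =>
    measurePreserving_sub_right volume w
  have h1 := tendsto_iff_edist_tendsto_0.1
    ((tendsto_const_nhds (x := hf.toLp f)).compMeasurePreservingLp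
    (hg.tendsto 0) hgm (hgm 0) ENNReal.ofReal_ne_top)
  refine h1.congr fun w => ?_
  rw [Lp.toLp_compMeasurePreserving hf (hgm w), Lp.toLp_compMeasurePreserving hf (hgm 0),
    Lp.edist_toLp_toLp, eLpNorm_eq_lintegral_rpow_enorm_toReal (by simp; linarith) (by simp),
    ENNReal.toReal_ofReal (by linarith)]
  simp [lpNrm, g, Real.enorm_eq_ofReal_abs]

lemma mixNrm_indicator_ne_top_of_isCompact (hp : 1 ≤ p) (hq : 1 ≤ q) {u : SpT d → ℝ≥0∞}
    (hu : Measurable u) (h : morreyNrm d p q β u ≠ ⊤) {K : Set (SpT d)} (hK : IsCompact K) :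
    mixNrm d p q (K.indicator u) ≠ ⊤ := by
  have hp0 : 0 < p := by linarith
  have hq0 : 0 < q := by linarith
  have key : ∃ s, MeasurableSet s ∧ K ⊆ s ∧ mixNrm d p q (s.indicator u) ≠ ⊤ := by
    refine hK.induction_on (p := fun A => ∃ s, MeasurableSet s ∧ A ⊆ s ∧
      mixNrm d p q (s.indicator u) ≠ ⊤) ?_ ?_ ?_ ?_
    · exact ⟨∅, MeasurableSet.empty, Subset.rfl, by simp [mixNrm_zero hp0 hq0]⟩
    · rintro A B hAB ⟨s, hs, hBs, hfin⟩
      exact ⟨s, hs, hAB.trans hBs, hfin⟩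
    · rintro A B ⟨s, hs, hAs, hsf⟩ ⟨t, ht, hBt, htf⟩
      refine ⟨s ∪ t, hs.union ht, union_subset_union hAs hBt, ne_top_of_le_ne_top
        (ENNReal.add_ne_top.2 ⟨hsf, htf⟩) ?_⟩
      refine (mixNrm_mono hp0 hq0 fun z => ?_).trans
        (mixNrm_add_le hp hq (hu.indicator hs) (hu.indicator ht))
      by_cases hz : z ∈ s <;> by_cases hz' : z ∈ t <;> simp [hz, hz']
    · intro z _
      refine ⟨pCyl d 1 (z.1 - 1 / 2) z.2, mem_nhdsWithin_of_mem_nhds ?_,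
        pCyl d 1 (z.1 - 1 / 2) z.2, measurableSet_pCyl _ _ _, Subset.rfl, ?_⟩
      · exact prod_mem_nhds (Ico_mem_nhds (by linarith) (by linarith)) (ball_mem_nhds _ one_pos)
      · have h1 := ne_top_of_le_ne_top h
          (le_morreyNrm one_pos le_rfl (z.1 - 1 / 2) z.2 u)
        intro htop
        refine h1 ?_
        rw [cylNrm, htop, ENNReal.mul_top, ENNReal.mul_top]
        · simp
        · unfold cylConst
          simp [ENNReal.rpow_eq_zero_iff, measure_ball_lt_top.ne, hp0.le, hp0]
  obtain ⟨s, -, hKs, hfin⟩ := key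
  exact ne_top_of_le_ne_top hfin (mixNrm_mono hp0 hq0 fun z =>
    indicator_le_indicator_of_subset hKs (fun _ => zero_le) z)

lemma tendsto_mixNrm_translate_sub (hp : 1 ≤ p) (hq : 1 ≤ q) {f : SpT d → ℝ} (hf : Measurable f)
    (hloc : ∀ R, mixNrm d p q ((closedBall 0 R).indicator fun z => ENNReal.ofReal |f z|) ≠ ⊤)
    (R : ℝ) :
    Tendsto (fun w => mixNrm d p q
      ((closedBall 0 R).indicator fun z => ENNReal.ofReal |f (z - w) - f z|)) (𝓝 0) (𝓝 0) := by
  have hp0 : 0 < p := by linarith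
  have hq0 : 0 < q := by linarith
  set K : Set (SpT d) := closedBall 0 (R + 1) with hK
  have hKm : MeasurableSet K := measurableSet_closedBall
  have hKs : ∀ z ∈ closedBall (0 : SpT d) R, ∀ w : SpT d, ‖w‖ ≤ 1 → z - w ∈ K := by
    intro z hz w hw
    rw [hK, mem_closedBall_zero_iff] at *
    exact (norm_sub_le z w).trans (by gcongr)
  let b : ℕ → SpT d → ℝ := fun n => (K ∩ {z | |f z| ≤ n}).indicator f
  let c : ℕ → SpT d → ℝ≥0∞ := fun n => (K ∩ {z | n < |f z|}).indicator fun z => ENNReal.ofReal |f z|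
  have hfa : Measurable fun z => ENNReal.ofReal |f z| := by fun_prop
  have hbm : ∀ n, Measurable (b n) := fun n =>
    hf.indicator (hKm.inter (measurableSet_le (f := fun z => |f z|) (by fun_prop) measurable_const))
  have hcm : ∀ n, Measurable (c n) := fun n =>
    hfa.indicator (hKm.inter
      (measurableSet_lt measurable_const (g := fun z => |f z|) (by fun_prop)))
  have hclim : Tendsto (fun n => mixNrm d p q (c n)) atTop (𝓝 0) := by
    refine tendsto_mixNrm_of_dominated hp0 hq0 hcm (hfa.indicator hKm) (hloc (R + 1))
      (fun n z => indicator_le_indicator_of_subset inter_subset_left (fun _ => zero_le) z)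
      fun z => ?_
    refine tendsto_const_nhds.congr' ?_
    filter_upwards [eventually_ge_atTop ⌈|f z|⌉₊] with n hn
    have : ¬ (n : ℝ) < |f z| := not_lt.2 (Nat.ceil_le.1 hn)
    simp [c, this]
  set r := max p q
  have hr1 : 1 ≤ r := hp.trans (le_max_left _ _)
  have hblim : ∀ n, Tendsto (fun w => mixNrm d p q
      ((closedBall 0 R).indicator fun z => ENNReal.ofReal |b n (z - w) - b n z|)) (𝓝 0) (𝓝 0) := by
    intro n
    have hmem : MemLp (b n) (ENNReal.ofReal r) volume := by
      have : MemLp (K.indicator fun _ => (n : ℝ)) (ENNReal.ofReal r) volume :=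
        memLp_indicator_const _ hKm _ (Or.inr measure_closedBall_lt_top.ne)
      refine this.mono (hbm n).aestronglyMeasurable (ae_of_all _ fun z => ?_)
      by_cases hz : z ∈ K ∩ {z | |f z| ≤ n}
      · have h2 : |f z| ≤ n := hz.2
        simp [b, hz, hz.1]
        simpa using h2
      · simp [b, hz]
    have hball : closedBall (0 : SpT d) R = closedBall (0 : ℝ) R ×ˢ closedBall (0 : Spc d) R :=
      (closedBall_prod_same _ _ _).symm
    have h0 := ENNReal.Tendsto.const_mul (tendsto_lpNrm_translate_sub hr1 hmem)
      (a := volume (closedBall (0 : Spc d) R) ^ (1 / p - 1 / r) *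
        volume (closedBall (0 : ℝ) R) ^ (1 / q - 1 / r)) (Or.inr (ENNReal.mul_ne_top
          (ENNReal.rpow_ne_top_of_nonneg (sub_nonneg.2
            (one_div_le_one_div_of_le hp0 (le_max_left _ _))) measure_closedBall_lt_top.ne)
          (ENNReal.rpow_ne_top_of_nonneg (sub_nonneg.2
            (one_div_le_one_div_of_le hq0 (le_max_right _ _))) measure_closedBall_lt_top.ne)))
    rw [mul_zero] at h0
    refine tendsto_of_tendsto_of_tendsto_of_le_of_le tendsto_const_nhds h0
      (fun _ => zero_le) fun w => ?_
    rw [hball]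
    have hbn := hbm n
    exact mixNrm_indicator_le_lintegral hp0 hq0 (le_max_left _ _) (le_max_right _ _) (by fun_prop)
      measurableSet_closedBall measurableSet_closedBall measure_closedBall_lt_top.ne
  refine ENNReal.tendsto_nhds_zero.2 fun δ hδ => ?_
  have hδ3 : 0 < δ / 3 := ENNReal.div_pos hδ.ne' (by simp)
  obtain ⟨n, hn⟩ := (ENNReal.tendsto_nhds_zero.1 hclim (δ / 3) hδ3).exists
  filter_upwards [ENNReal.tendsto_nhds_zero.1 (hblim n) (δ / 3) hδ3,
    closedBall_mem_nhds (0 : SpT d) one_pos] with w hw hw1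
  have hw1' : ‖w‖ ≤ 1 := by simpa using hw1
  have hsplit : ∀ z ∈ K, ∀ y ∈ K, ENNReal.ofReal |f z - f y| ≤
      c n z + c n y + ENNReal.ofReal |b n z - b n y| := by
    have hbc : ∀ z ∈ K, ENNReal.ofReal |f z - b n z| ≤ c n z := by
      intro z hz
      rcases le_or_gt |f z| n with h | h
      · simp [b, hz, h]
      · simp [b, c, hz, h, not_le.2 h]
    intro z hz y hy
    calc ENNReal.ofReal |f z - f y|
        ≤ ENNReal.ofReal (|f z - b n z| + |f y - b n y| + |b n z - b n y|) := by
          refine ENNReal.ofReal_le_ofReal ?_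
          have e : f z - f y = (f z - b n z) - (f y - b n y) + (b n z - b n y) := by ring
          rw [e]
          exact (abs_add_le _ _).trans (by gcongr; exact abs_sub _ _)
      _ ≤ _ := by
          rw [ENNReal.ofReal_add (by positivity) (by positivity),
            ENNReal.ofReal_add (by positivity) (by positivity)]
          gcongr
          exacts [hbc z hz, hbc y hy]
  have hcn := hcm n
  have hbn := hbm n
  have hcw : Measurable fun z => c n (z - w) := by fun_prop
  have hlast : Measurable ((closedBall (0 : SpT d) R).indicator fun z =>
      ENNReal.ofReal |b n (z - w) - b n z|) :=
    Measurable.indicator (by fun_prop) measurableSet_closedBall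
  calc mixNrm d p q ((closedBall 0 R).indicator fun z => ENNReal.ofReal |f (z - w) - f z|)
      ≤ mixNrm d p q (fun z => (c n (z - w) + c n z) +
        (closedBall 0 R).indicator (fun z => ENNReal.ofReal |b n (z - w) - b n z|) z) := by
        refine mixNrm_mono hp0 hq0 fun z => ?_
        by_cases hz : z ∈ closedBall (0 : SpT d) R
        · simp only [indicator_of_mem hz]
          exact hsplit _ (hKs z hz w hw1') _ (by simpa using hKs z hz 0 (by simp))
        · simp [indicator_of_notMem hz]
    _ ≤ mixNrm d p q (fun z => c n (z - w)) + mixNrm d p q (c n) + mixNrm d p q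
        ((closedBall 0 R).indicator fun z => ENNReal.ofReal |b n (z - w) - b n z|) :=
        (mixNrm_add_le hp hq (hcw.add hcn) hlast).trans
          (by gcongr; exact mixNrm_add_le hp hq hcw hcn)
    _ ≤ δ / 3 + δ / 3 + δ / 3 := by
        rw [mixNrm_translate]
        gcongr
    _ = δ := ENNReal.add_thirds δ

end LocalContinuity

section Mollification

variable {d : ℕ} {p q β ε : ℝ} {ζ f : SpT d → ℝ}

/-- The rescaled kernel `ζ_ε(t,x) = ε^{-d-2} ζ(t/ε², x/ε)`. -/
def mollifierKernel (d : ℕ) (ζ : SpT d → ℝ) (ε : ℝ) (w : SpT d) : ℝ :=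
  ε ^ (-(d : ℝ) - 2) * ζ (w.1 / ε ^ 2, ε⁻¹ • w.2)

lemma mollify_eq_integral (z : SpT d) :
    mollify d ζ ε f z = ∫ w, mollifierKernel d ζ ε w * f (z - w) := rfl

lemma IsMollifier.continuous_mollifierKernel (hζ : IsMollifier d ζ) :
    Continuous (mollifierKernel d ζ ε) := by
  have := hζ.1.continuous
  unfold mollifierKernel
  fun_prop

lemma IsMollifier.mollifierKernel_nonneg (hζ : IsMollifier d ζ) (hε : 0 < ε) (w : SpT d) :
    0 ≤ mollifierKernel d ζ ε w :=
  mul_nonneg (by positivity) (hζ.2.1 _)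

lemma IsMollifier.norm_le_of_mollifierKernel_ne_zero (hζ : IsMollifier d ζ) (hε : 0 < ε)
    (hε1 : ε ≤ 1) {w : SpT d} (hw : mollifierKernel d ζ ε w ≠ 0) : ‖w‖ ≤ ε := by
  obtain ⟨⟨h1, h2⟩, h3⟩ := hζ.2.2.2 (right_ne_zero_of_mul hw)
  refine norm_prod_le_iff.2 ⟨?_, ?_⟩
  · rw [le_div_iff₀ (by positivity)] at h1
    rw [div_lt_iff₀ (by positivity)] at h2
    rw [Real.norm_eq_abs, abs_le]
    constructor <;> nlinarith
  · rw [mem_ball_zero_iff, norm_smul, norm_inv, Real.norm_eq_abs, abs_of_pos hε,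
      inv_mul_lt_iff₀ hε, mul_one] at h3
    exact h3.le

lemma IsMollifier.integrable_mollifierKernel (hζ : IsMollifier d ζ) (hε : 0 < ε) (hε1 : ε ≤ 1) :
    Integrable (mollifierKernel d ζ ε) :=
  hζ.continuous_mollifierKernel.integrable_of_hasCompactSupport <|
    HasCompactSupport.of_support_subset_isCompact (isCompact_closedBall 0 ε) fun _ hw =>
      mem_closedBall_zero_iff.2 (hζ.norm_le_of_mollifierKernel_ne_zero hε hε1 hw)

lemma mollifierKernel_one : mollifierKernel d ζ 1 = ζ := by
  ext w
  simp [mollifierKernel]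

lemma IsMollifier.integral_mollifierKernel (hζ : IsMollifier d ζ) (hε : 0 < ε) (hε1 : ε ≤ 1) :
    ∫ w, mollifierKernel d ζ ε w = 1 := by
  have hζint := hζ.integrable_mollifierKernel one_pos le_rfl
  rw [mollifierKernel_one, Measure.volume_eq_prod] at hζint
  have hkint := hζ.integrable_mollifierKernel hε hε1
  have h1 := hζ.2.2.1
  rw [Measure.volume_eq_prod] at hkint h1 ⊢
  rw [integral_prod _ hζint] at h1
  rw [integral_prod _ hkint]
  simp only [mollifierKernel, integral_const_mul]
  simp_rw [fun t : ℝ => Measure.integral_comp_inv_smul_of_nonneg (volume : Measure (Spc d))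
    (fun x => ζ (t / ε ^ 2, x)) hε.le]
  simp only [smul_eq_mul, integral_const_mul]
  rw [Measure.integral_comp_div (fun t => ∫ x, ζ (t, x)) (ε ^ 2), h1, finrank_euclideanSpace_fin,
    smul_eq_mul, mul_one, abs_of_pos (by positivity), ← Real.rpow_natCast, ← Real.rpow_natCast,
    ← Real.rpow_add hε, ← Real.rpow_add hε]
  norm_num

/-- The probability measure with density the rescaled kernel. -/
def mollifierMeasure (d : ℕ) (ζ : SpT d → ℝ) (ε : ℝ) : Measure (SpT d) :=
  volume.withDensity fun w => ENNReal.ofReal (mollifierKernel d ζ ε w)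

lemma IsMollifier.isProbabilityMeasure (hζ : IsMollifier d ζ) (hε : 0 < ε) (hε1 : ε ≤ 1) :
    IsProbabilityMeasure (mollifierMeasure d ζ ε) :=
  isProbabilityMeasure_withDensity_ofReal (hζ.integrable_mollifierKernel hε hε1)
    (hζ.mollifierKernel_nonneg hε) (hζ.integral_mollifierKernel hε hε1)

lemma IsMollifier.ae_norm_le (hζ : IsMollifier d ζ) (hε : 0 < ε) (hε1 : ε ≤ 1) :
    ∀ᵐ w ∂mollifierMeasure d ζ ε, ‖w‖ ≤ ε := by
  have := hζ.continuous_mollifierKernel (ε := ε)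
  rw [mollifierMeasure, ae_withDensity_iff (by fun_prop)]
  refine ae_of_all _ fun w hw => hζ.norm_le_of_mollifierKernel_ne_zero hε hε1 fun h0 => hw ?_
  rw [h0, ENNReal.ofReal_zero]

lemma IsMollifier.measurable_mollify (hζ : IsMollifier d ζ) (hf : Measurable f) :
    Measurable (mollify d ζ ε f) := by
  have := (hζ.continuous_mollifierKernel (ε := ε)).measurable
  have hm : Measurable fun y : SpT d × SpT d => mollifierKernel d ζ ε y.2 * f (y.1 - y.2) := by
    fun_prop
  exact hm.stronglyMeasurable.integral_prod_right'.measurable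

lemma IsMollifier.ofReal_abs_sub_mollify_le (hζ : IsMollifier d ζ) (hε : 0 < ε) (hε1 : ε ≤ 1)
    (hf : Measurable f) (z : SpT d) :
    ENNReal.ofReal |f z - mollify d ζ ε f z| ≤
      ∫⁻ w, ENNReal.ofReal |f (z - w) - f z| ∂mollifierMeasure d ζ ε := by
  have hk := (hζ.continuous_mollifierKernel (ε := ε)).measurable
  have e : ∫⁻ w, ENNReal.ofReal |f (z - w) - f z| ∂mollifierMeasure d ζ ε =
      ∫⁻ w, ‖mollifierKernel d ζ ε w * (f (z - w) - f z)‖ₑ := by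
    rw [mollifierMeasure, lintegral_withDensity_eq_lintegral_mul _ (by fun_prop) (by fun_prop)]
    refine lintegral_congr fun w => ?_
    rw [enorm_mul, Real.enorm_eq_ofReal (hζ.mollifierKernel_nonneg hε w),
      Real.enorm_eq_ofReal_abs, Pi.mul_apply]
  rw [e]
  by_cases htop : ∫⁻ w, ‖mollifierKernel d ζ ε w * (f (z - w) - f z)‖ₑ = ⊤
  · exact htop ▸ le_top
  have hm : Measurable fun w => mollifierKernel d ζ ε w * (f (z - w) - f z) := by fun_prop
  have h1 : Integrable fun w => mollifierKernel d ζ ε w * (f (z - w) - f z) :=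
    ⟨hm.aestronglyMeasurable, lt_top_iff_ne_top.2 htop⟩
  have h2 := (hζ.integrable_mollifierKernel hε hε1).mul_const (f z)
  have h3 : mollify d ζ ε f z - f z = ∫ w, mollifierKernel d ζ ε w * (f (z - w) - f z) := by
    have h4 : mollify d ζ ε f z = ∫ w, (mollifierKernel d ζ ε w * (f (z - w) - f z) +
        mollifierKernel d ζ ε w * f z) := by
      rw [mollify_eq_integral]
      congr 1
      ext w
      ring
    rw [h4, integral_add h1 h2, integral_mul_const, hζ.integral_mollifierKernel hε hε1]
    ring
  rw [abs_sub_comm, h3, ← Real.enorm_eq_ofReal_abs]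
  exact enorm_integral_le_lintegral_enorm _

lemma mollify_congr_ae {g : SpT d → ℝ} (h : f =ᵐ[volume] g) :
    mollify d ζ ε f = mollify d ζ ε g := by
  ext z
  simp only [mollify_eq_integral]
  refine integral_congr_ae ?_
  have := (quasiMeasurePreserving_sub_left volume z).ae_eq_comp h
  filter_upwards [this] with w hw
  simp only [Function.comp_apply] at hw
  rw [hw]

lemma morreyNrm_add_le (hp : 1 ≤ p) (hq : 1 ≤ q) {u v : SpT d → ℝ≥0∞} (hu : Measurable u)
    (hv : Measurable v) : morreyNrm d p q β (fun z => u z + v z) ≤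
      morreyNrm d p q β u + morreyNrm d p q β v :=
  morreyNrm_le fun ρ hρ hρ1 t x => by
    calc _ ≤ ENNReal.ofReal (ρ ^ β) * (cylNrm d p q ρ t x u + cylNrm d p q ρ t x v) := by
          gcongr
          exact cylNrm_add_le hp hq hu hv
      _ ≤ _ := by
          rw [mul_add]
          exact add_le_add (le_morreyNrm hρ hρ1 t x u) (le_morreyNrm hρ hρ1 t x v)

lemma morreyNrm_const_mul_le (hp : 0 < p) (hq : 0 < q) {c : ℝ≥0∞} (hc : c ≠ ⊤)
    (u : SpT d → ℝ≥0∞) : morreyNrm d p q β (fun z => c * u z) ≤ c * morreyNrm d p q β u :=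
  morreyNrm_le fun ρ hρ hρ1 t x => by
    rw [cylNrm_const_mul hp hq hc, mul_left_comm]
    gcongr
    exact le_morreyNrm hρ hρ1 t x u

lemma IsMollifier.morreyNrm_sub_mollify_le (hp : 1 < p) (hq : 1 < q) (hζ : IsMollifier d ζ)
    (hε : 0 < ε) (hε1 : ε ≤ 1) (hf : Measurable f) :
    morreyNrm d p q β (fun z => ENNReal.ofReal |f z - mollify d ζ ε f z|) ≤
      2 * morreyNrm d p q β fun z => ENNReal.ofReal |f z| := by
  have := hζ.isProbabilityMeasure hε hε1
  have hA : Measurable fun z =>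
      ∫⁻ w, ENNReal.ofReal |f (z - w)| ∂mollifierMeasure d ζ ε :=
    Measurable.lintegral_prod_right' (f := fun y : SpT d × SpT d => ENNReal.ofReal |f (y.1 - y.2)|)
      (by fun_prop)
  calc morreyNrm d p q β (fun z => ENNReal.ofReal |f z - mollify d ζ ε f z|)
      ≤ morreyNrm d p q β (fun z =>
        ∫⁻ w, ENNReal.ofReal |f (z - w)| ∂mollifierMeasure d ζ ε + ENNReal.ofReal |f z|) := by
        refine morreyNrm_mono (by linarith) (by linarith) fun z =>
          (hζ.ofReal_abs_sub_mollify_le hε hε1 hf z).trans ?_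
        calc _ ≤ ∫⁻ w, (ENNReal.ofReal |f (z - w)| + ENNReal.ofReal |f z|)
              ∂mollifierMeasure d ζ ε := lintegral_mono fun w => by
                rw [← ENNReal.ofReal_add (abs_nonneg _) (abs_nonneg _)]
                exact ENNReal.ofReal_le_ofReal (abs_sub _ _)
          _ = _ := by
            rw [lintegral_add_right _ measurable_const]
            simp
    _ ≤ _ := by
        rw [two_mul]
        refine (morreyNrm_add_le hp.le hq.le hA (by fun_prop)).trans ?_
        gcongr
        exact morreyNrm_average_le hp hq (mollifierMeasure d ζ ε)
          (v := fun z => ENNReal.ofReal |f z|) (by fun_prop) fun z => le_rfl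

lemma IsMollifier.tendsto_mixNrm_sub_mollify (hp : 1 < p) (hq : 1 < q) (hζ : IsMollifier d ζ)
    (hf : Measurable f)
    (hloc : ∀ R, mixNrm d p q ((closedBall 0 R).indicator fun z => ENNReal.ofReal |f z|) ≠ ⊤)
    (R : ℝ) :
    Tendsto (fun ε => mixNrm d p q ((closedBall 0 R).indicator
      fun z => ENNReal.ofReal |f z - mollify d ζ ε f z|)) (𝓝[>] 0) (𝓝 0) := by
  have hlim := tendsto_mixNrm_translate_sub hp.le hq.le hf hloc R
  refine ENNReal.tendsto_nhds_zero.2 fun δ hδ => ?_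
  obtain ⟨s, hs, hle⟩ := Metric.eventually_nhds_iff.1 (ENNReal.tendsto_nhds_zero.1 hlim δ hδ)
  filter_upwards [Ioo_mem_nhdsGT (lt_min hs one_pos)] with ε hε
  obtain ⟨hε0, hε1⟩ := hε
  have hεs := hε1.trans_le (min_le_left _ _)
  replace hε1 := (hε1.trans_le (min_le_right _ _)).le
  have := hζ.isProbabilityMeasure hε0 hε1
  have hm : Measurable ((closedBall (0 : SpT d) R ×ˢ (univ : Set (SpT d))).indicator
      fun y => ENNReal.ofReal |f (y.1 - y.2) - f y.1|) :=
    Measurable.indicator (by fun_prop) (measurableSet_closedBall.prod MeasurableSet.univ)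
  calc _ ≤ mixNrm d p q (fun z => ∫⁻ w, (closedBall (0 : SpT d) R ×ˢ univ).indicator
        (fun y => ENNReal.ofReal |f (y.1 - y.2) - f y.1|) (z, w) ∂mollifierMeasure d ζ ε) := by
        refine mixNrm_mono (by linarith) (by linarith) fun z => ?_
        by_cases hz : z ∈ closedBall (0 : SpT d) R
        · have h1 : ∀ w : SpT d, (z, w) ∈ closedBall (0 : SpT d) R ×ˢ (univ : Set (SpT d)) :=
            fun w => ⟨hz, mem_univ _⟩
          simp only [indicator_of_mem hz, indicator_of_mem (h1 _)]
          exact hζ.ofReal_abs_sub_mollify_le hε0 hε1 hf z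
        · simp [indicator_of_notMem hz]
    _ ≤ ∫⁻ w, mixNrm d p q ((closedBall 0 R).indicator
        fun z => ENNReal.ofReal |f (z - w) - f z|) ∂mollifierMeasure d ζ ε := by
        refine (mixNrm_lintegral_le hp hq _ hm).trans_eq (lintegral_congr fun w => ?_)
        congr 1
        ext z
        by_cases hz : z ∈ closedBall (0 : SpT d) R
        · have h1 : (z, w) ∈ closedBall (0 : SpT d) R ×ˢ (univ : Set (SpT d)) := ⟨hz, mem_univ _⟩
          simp only [indicator_of_mem hz, indicator_of_mem h1]
        · have h1 : (z, w) ∉ closedBall (0 : SpT d) R ×ˢ (univ : Set (SpT d)) := fun h => hz h.1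
          simp only [indicator_of_notMem hz, indicator_of_notMem h1]
    _ ≤ ∫⁻ _, δ ∂mollifierMeasure d ζ ε := by
        refine lintegral_mono_ae ?_
        filter_upwards [hζ.ae_norm_le hε0 hε1] with w hw
        exact hle (by simpa using hw.trans_lt hεs)
    _ = δ := by simp

lemma pCyl_subset_closedBall {ρ t n : ℝ} {x : Spc d} (hρ : 0 < ρ) (hρ1 : ρ ≤ 1)
    (ht : |t| ≤ n) (hx : ‖x‖ ≤ n) : pCyl d ρ t x ⊆ closedBall 0 (n + 1) := by
  rintro z ⟨⟨h1, h2⟩, h3⟩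
  rw [mem_closedBall_zero_iff]
  refine norm_prod_le_iff.2 ⟨?_, ?_⟩
  · rw [abs_le] at ht
    rw [Real.norm_eq_abs, abs_le]
    constructor <;> nlinarith
  · have : ‖z.2‖ ≤ ‖x‖ + dist z.2 x := by
      rw [dist_eq_norm]
      calc ‖z.2‖ = ‖x + (z.2 - x)‖ := by simp
        _ ≤ _ := norm_add_le _ _
    rw [mem_ball] at h3
    linarith

lemma IsMollifier.tendsto_lintegral_mul_sub_mollify (hp : 1 < p) (hq : 1 < q) (hβ : 0 < β)
    (hζ : IsMollifier d ζ) {G : SpT d → ℝ≥0∞} (hG : Measurable G)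
    (H : ∀ u : SpT d → ℝ≥0∞, Measurable u → ∫⁻ z, G z * u z ≤ morreyNrm d p q β u)
    (hf : Measurable f) (hfin : morreyNrm d p q β (fun z => ENNReal.ofReal |f z|) ≠ ⊤) :
    Tendsto (fun ε => ∫⁻ z, G z * ENNReal.ofReal |f z - mollify d ζ ε f z|) (𝓝[>] 0) (𝓝 0) := by
  have hp0 : 0 < p := by linarith
  have hq0 : 0 < q := by linarith
  set c : ℝ≥0∞ := 2 * morreyNrm d p q β (fun z => ENNReal.ofReal |f z|) + 1 with hc
  have hc0 : c ≠ 0 := by simp [hc]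
  have hct : c ≠ ⊤ := ENNReal.add_ne_top.2 ⟨ENNReal.mul_ne_top (by simp) hfin, by simp⟩
  have hcinv : c⁻¹ ≠ ⊤ := ENNReal.inv_ne_top.2 hc0
  refine ENNReal.tendsto_nhds_zero.2 fun δ hδ => ?_
  obtain ⟨m, hm⟩ := exists_forall_spreadBall_le hp hq hβ hG H
    (a := δ / c) (ENNReal.div_pos hδ.ne' hct).ne'
  set n := m + 1 with hn
  have hn0 : (0 : ℝ) < n := by positivity
  have hlim := ENNReal.Tendsto.const_mul (hζ.tendsto_mixNrm_sub_mollify hp hq hf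
    (fun R => mixNrm_indicator_ne_top_of_isCompact hp.le hq.le (by fun_prop) hfin
      (isCompact_closedBall 0 R)) (n + 1))
    (a := cylConst d p q (1 / n)) (Or.inr (cylConst_ne_top (by positivity)))
  rw [mul_zero] at hlim
  filter_upwards [ENNReal.tendsto_nhds_zero.1 hlim (n : ℝ≥0∞)⁻¹ (by simp),
    Ioo_mem_nhdsGT one_pos] with ε hsmall hε
  obtain ⟨hε0, hε1⟩ := hε
  have hmeas : Measurable fun z => ENNReal.ofReal |f z - mollify d ζ ε f z| := by
    have := hζ.measurable_mollify (ε := ε) hf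
    fun_prop
  have hmem : (fun z => c⁻¹ * ENNReal.ofReal |f z - mollify d ζ ε f z|) ∈
      spreadBall d p q β n := by
    refine ⟨hmeas.const_mul _, ?_, fun ρ hρ hρ1 hnρ t x ht hx => ?_⟩
    · calc _ ≤ c⁻¹ * c := by
            refine (morreyNrm_const_mul_le hp0 hq0 hcinv _).trans ?_
            gcongr
            exact (hζ.morreyNrm_sub_mollify_le hp hq hε0 hε1.le hf).trans le_self_add
        _ = 1 := ENNReal.inv_mul_cancel hc0 hct
    · have hρn : 1 / (n : ℝ) ≤ ρ := by
        rw [div_le_iff₀ hn0]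
        linarith
      rw [cylNrm_const_mul hp0 hq0 hcinv]
      calc _ ≤ 1 * (1 * (cylConst d p q (1 / n) * mixNrm d p q ((closedBall 0 (n + 1)).indicator
              fun z => ENNReal.ofReal |f z - mollify d ζ ε f z|))) := by
            gcongr
            · exact ENNReal.ofReal_le_one.2 (Real.rpow_le_one hρ.le hρ1 hβ.le)
            · rw [ENNReal.inv_le_one]
              exact le_add_self
            · exact mul_le_mul' (cylConst_anti hp0 hq0 (by positivity) hρn)
                (mixNrm_mono hp0 hq0 fun z => indicator_le_indicator_of_subset
                  (pCyl_subset_closedBall hρ hρ1 ht hx) (fun _ => zero_le) z)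
        _ ≤ _ := by simpa using hsmall
  calc ∫⁻ z, G z * ENNReal.ofReal |f z - mollify d ζ ε f z|
      = c * ∫⁻ z, G z * (c⁻¹ * ENNReal.ofReal |f z - mollify d ζ ε f z|) := by
        rw [← lintegral_const_mul' _ _ hct]
        refine lintegral_congr fun z => ?_
        rw [mul_left_comm, ← mul_assoc c, ENNReal.mul_inv_cancel hc0 hct, one_mul]
    _ ≤ c * (δ / c) := by
        gcongr
        exact hm _ (spreadBall_anti (Nat.le_succ m) hmem)
    _ = δ := ENNReal.mul_div_cancel hc0 hct

end Mollification

/-- Lemma 7,4.3: if `g ≥ 0` is Borel and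
    `∫ g·|f| ≤ ‖f‖_{E_{p,q,β}}` for every bounded smooth `f`, then the same
    inequality holds for every `f ∈ E_{p,q,β}`, and moreover
    `∫ g·|f - f^{(ε)}| → 0` as `ε ↓ 0`. -/
theorem statement1 (d : ℕ) (hd : 1 ≤ d) (p q β : ℝ)
    (hp : 1 < p) (hq : 1 < q) (hβ : 0 < β)
    (g : SpT d → ℝ) (hgm : Measurable g) (hg0 : ∀ z, 0 ≤ g z)
    (H : ∀ f : SpT d → ℝ, ContDiff ℝ (⊤ : ℕ∞) f → (∃ M, ∀ z, |f z| ≤ M) →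
      (∫⁻ z : SpT d, ENNReal.ofReal (g z) * ENNReal.ofReal |f z|) ≤ morreyNorm d p q β f)
    (f : SpT d → ℝ) (hf : MemE d p q β f) :
    ((∫⁻ z : SpT d, ENNReal.ofReal (g z) * ENNReal.ofReal |f z|) ≤ morreyNorm d p q β f) ∧
    ∀ ζ : SpT d → ℝ, IsMollifier d ζ →
      Tendsto (fun ε : ℝ =>
          ∫⁻ z : SpT d, ENNReal.ofReal (g z) * ENNReal.ofReal |f z - mollify d ζ ε f z|)
        (𝓝[>] (0 : ℝ)) (𝓝 0) := by
  have hp0 : 0 < p := by linarith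
  have hq0 : 0 < q := by linarith
  have hG : Measurable fun z => ENNReal.ofReal (g z) := by fun_prop
  have H' : ∀ u : SpT d → ℝ≥0∞, Measurable u →
      ∫⁻ z, ENNReal.ofReal (g z) * u z ≤ morreyNrm d p q β u := fun u hu =>
    lintegral_mul_le_morreyNrm hp hq hG (fun z => ENNReal.ofReal_ne_top) H hu
  obtain ⟨hfm, hfin⟩ := hf
  set f' := hfm.mk f
  have hf'm : Measurable f' := hfm.stronglyMeasurable_mk.measurable
  have hae : f =ᵐ[volume] f' := hfm.ae_eq_mk
  have hnorm : morreyNorm d p q β f = morreyNrm d p q β fun z => ENNReal.ofReal |f' z| := by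
    rw [morreyNorm_eq_morreyNrm hp0 hq0]
    refine morreyNrm_congr_ae ?_
    filter_upwards [hae] with z hz
    rw [hz]
  constructor
  · rw [hnorm]
    refine le_trans (lintegral_congr_ae ?_).le (H' _ (by fun_prop))
    filter_upwards [hae] with z hz
    rw [hz]
  · intro ζ hζ
    rw [hnorm] at hfin
    refine (hζ.tendsto_lintegral_mul_sub_mollify hp hq hβ hG H' hf'm hfin).congr fun ε => ?_
    refine lintegral_congr_ae ?_
    filter_upwards [hae] with z hz
    rw [hz, mollify_congr_ae hae]
end
end

section
/- Let d ≥ 1, p,q ∈ (1,∞) and 1 < β ≤ d/p + 2/q. Set p₀ := βp, q₀ := βq, s := βp/(β−1), r := βq/(β−1). Then for all measurable functions f, g on ℝ^{d+1} one has ‖f·g‖_{E_{p,q,β}} ≤ ‖f‖_{E_{p₀,q₀,1}} · ‖g‖_{E_{s,r,β−1}}. -/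
open MeasureTheory ENNReal NNReal Metric Set Filter Topology

noncomputable section

/-- Hölder's inequality for averages, in weighted form. -/
theorem setLIntegral_div_rpow_mul_rpow_le {α : Type*} [MeasurableSpace α] (μ : Measure α)
    (S : Set α) (c : ℝ≥0∞) {F G : α → ℝ≥0∞} (hF : Measurable F) (hG : Measurable G)
    {a b : ℝ} (ha : 0 ≤ a) (hb : 0 ≤ b) (hab : a + b = 1) :
    (∫⁻ x in S, F x ^ a * G x ^ b ∂μ) / c ≤
      ((∫⁻ x in S, F x ∂μ) / c) ^ a * ((∫⁻ x in S, G x ∂μ) / c) ^ b := by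
  have h := ENNReal.lintegral_mul_norm_pow_le (μ := c⁻¹ • μ.restrict S)
    hF.aemeasurable hG.aemeasurable ha hb hab
  simpa only [lintegral_smul_measure, smul_eq_mul, mul_comm c⁻¹, ← div_eq_mul_inv] using h

theorem measurable_setLIntegral_ball_div_rpow (d : ℕ) {f : SpT d → ℝ} (hf : Measurable f)
    (p e ρ : ℝ) (x₀ : Spc d) :
    Measurable fun t : ℝ =>
      ((∫⁻ x in Metric.ball x₀ ρ, ENNReal.ofReal |f (t, x)| ^ p) /
        volume (Metric.ball x₀ ρ)) ^ e := by
  have h : Measurable fun z : SpT d => ENNReal.ofReal |f z| ^ p :=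
    (ENNReal.measurable_ofReal.comp hf.abs).pow_const p
  exact ((h.lintegral_prod_right' (ν := volume.restrict (Metric.ball x₀ ρ))).div_const _).pow_const e

/-- Hölder's inequality for the normalized mixed norm on a cylinder. -/
theorem avgLpq_mul_le (d : ℕ) {p q β : ℝ} (hp : 0 < p) (hq : 0 < q) (hβ : 1 < β)
    {f g : SpT d → ℝ} (hf : Measurable f) (hg : Measurable g) (ρ t₀ : ℝ) (x₀ : Spc d) :
    avgLpq d p q ρ t₀ x₀ (fun z => f z * g z) ≤
      avgLpq d (β * p) (β * q) ρ t₀ x₀ f *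
        avgLpq d (β * p / (β - 1)) (β * q / (β - 1)) ρ t₀ x₀ g := by
  have hβ0 : 0 < β := by linarith
  have hβ1 : 0 < β - 1 := by linarith
  have ha : 0 ≤ 1 / β := by positivity
  have hb : 0 ≤ (β - 1) / β := by positivity
  have hab : 1 / β + (β - 1) / β = 1 := by field_simp; ring
  have e₁ : β * q / (β * p) = q / p := by field_simp
  have e₂ : β * q / (β - 1) / (β * p / (β - 1)) = q / p := by field_simp
  have e₃ : 1 / (β * q) = 1 / β * (1 / q) := by field_simp
  have e₄ : 1 / (β * q / (β - 1)) = (β - 1) / β * (1 / q) := by field_simp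
  have hp₁ : β * p * (1 / β) = p := by field_simp
  have hp₂ : β * p / (β - 1) * ((β - 1) / β) = p := by field_simp
  unfold avgLpq
  rw [e₁, e₂, e₃, e₄, ENNReal.rpow_mul, ENNReal.rpow_mul,
    ← ENNReal.mul_rpow_of_nonneg _ _ (by positivity : 0 ≤ 1 / q)]
  refine ENNReal.rpow_le_rpow ?_ (by positivity)
  refine le_trans (ENNReal.div_le_div_right (lintegral_mono fun t => ?_) _)
    (setLIntegral_div_rpow_mul_rpow_le volume _ _
      (measurable_setLIntegral_ball_div_rpow d hf (β * p) (q / p) ρ x₀)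
      (measurable_setLIntegral_ball_div_rpow d hg (β * p / (β - 1)) (q / p) ρ x₀) ha hb hab)
  have hF : Measurable fun x : Spc d => ENNReal.ofReal |f (t, x)| ^ (β * p) :=
    (ENNReal.measurable_ofReal.comp (hf.comp measurable_prodMk_left).abs).pow_const _
  have hG : Measurable fun x : Spc d => ENNReal.ofReal |g (t, x)| ^ (β * p / (β - 1)) :=
    (ENNReal.measurable_ofReal.comp (hg.comp measurable_prodMk_left).abs).pow_const _
  have h := setLIntegral_div_rpow_mul_rpow_le volume (Metric.ball x₀ ρ)
    (volume (Metric.ball x₀ ρ)) hF hG ha hb hab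
  simp only [← ENNReal.rpow_mul, hp₁, hp₂] at h
  simp only [← ENNReal.mul_rpow_of_nonneg _ _ hp.le, ← ENNReal.ofReal_mul (abs_nonneg _),
    ← abs_mul] at h
  refine (ENNReal.rpow_le_rpow h (by positivity : 0 ≤ q / p)).trans_eq ?_
  rw [ENNReal.mul_rpow_of_nonneg _ _ (by positivity : 0 ≤ q / p)]
  simp only [← ENNReal.rpow_mul, mul_comm (q / p)]

theorem le_morreyNorm (d : ℕ) (p q β : ℝ) (f : SpT d → ℝ) {ρ : ℝ} (h0 : 0 < ρ) (h1 : ρ ≤ 1)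
    (t₀ : ℝ) (x₀ : Spc d) :
    ENNReal.ofReal (ρ ^ β) * avgLpq d p q ρ t₀ x₀ f ≤ morreyNorm d p q β f :=
  le_iSup_of_le ρ <| le_iSup_of_le h0 <| le_iSup_of_le h1 <| le_iSup_of_le t₀ <|
    le_iSup_of_le x₀ le_rfl

/-- Lemma 6,11.1: with `(p₀,q₀) = β(p,q)` and
    `(s,r) = β(p,q)/(β-1)`, for all `f, g` one has
    `‖fg‖_{E_{p,q,β}} ≤ ‖f‖_{E_{p₀,q₀,1}} · ‖g‖_{E_{s,r,β-1}}`. -/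
theorem statement6 (d : ℕ) (hd : 1 ≤ d) (p q β : ℝ)
    (hp : 1 < p) (hq : 1 < q) (hβ1 : 1 < β) (hβ : β ≤ (d : ℝ) / p + 2 / q)
    (f g : SpT d → ℝ) (hf : Measurable f) (hg : Measurable g) :
    morreyNorm d p q β (fun z => f z * g z) ≤
      morreyNorm d (β * p) (β * q) 1 f *
        morreyNorm d (β * p / (β - 1)) (β * q / (β - 1)) (β - 1) g := by
  refine iSup_le fun ρ => iSup_le fun h0 => iSup_le fun h1 => iSup_le fun t₀ => iSup_le fun x₀ => ?_
  have hρ : ENNReal.ofReal (ρ ^ β) = ENNReal.ofReal (ρ ^ (1 : ℝ)) * ENNReal.ofReal (ρ ^ (β - 1)) := by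
    rw [← ENNReal.ofReal_mul (by positivity), ← Real.rpow_add h0, add_sub_cancel]
  calc _ ≤ ENNReal.ofReal (ρ ^ β) * (avgLpq d (β * p) (β * q) ρ t₀ x₀ f *
        avgLpq d (β * p / (β - 1)) (β * q / (β - 1)) ρ t₀ x₀ g) := by
        gcongr
        exact avgLpq_mul_le d (by linarith) (by linarith) hβ1 hf hg ρ t₀ x₀
    _ = _ := by rw [hρ, mul_mul_mul_comm]
    _ ≤ _ := mul_le_mul' (le_morreyNorm d _ _ _ f h0 h1 t₀ x₀) (le_morreyNorm d _ _ _ g h0 h1 t₀ x₀)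
end
end
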